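/- arXiv:math/0312080 — 6 statements merged into one kernel-verified Lean document; each statement's English description precedes it below -/
import Mathlib

section
/- The limit of a locally convergent sequence of solutions of the minimal surface equation inherits the boundary value +∞: Let (uₙ) be a sequence of solutions of the minimal surface equation on the open unit square (0,1)² such that uₙ converges, together with its first partial derivatives, uniformly on every compact subset of (0,1)² to a solution u of the minimal surface equation. Assume that one of the following two conditions holds: (i) for every n and every y₀ ∈ (0,1), uₙ(x,y) → +∞ as (x,y) ∈ (0,1)² tends to (1,y₀); or (ii) each uₙ is the restriction to (0,1)² of a solution vₙ of the minimal surface equation on (0,2) × (0,1), and for every y ∈ (0,1) one has (∂vₙ/∂x / Wₙ)(1,y) → 1, (∂vₙ/∂y / Wₙ)(1,y) → 0 and (1/Wₙ)(1,y) → 0 as n → ∞. Then for every y₀ ∈ (0,1), u(x,y) → +∞ as (x,y) ∈ (0,1)² tends to (1,y₀). -/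
open Real Filter Set

/-- First partial derivative (in the `x` direction) of a function on `ℝ × ℝ`. -/
noncomputable def pd1 (u : ℝ × ℝ → ℝ) (z : ℝ × ℝ) : ℝ := fderiv ℝ u z (1, 0)

/-- Second partial derivative (in the `y` direction) of a function on `ℝ × ℝ`. -/
noncomputable def pd2 (u : ℝ × ℝ → ℝ) (z : ℝ × ℝ) : ℝ := fderiv ℝ u z (0, 1)

/-- `W = √(1 + p² + q²)` associated to a function `u` on `ℝ × ℝ`. -/
noncomputable def Wf (u : ℝ × ℝ → ℝ) (z : ℝ × ℝ) : ℝ :=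
  Real.sqrt (1 + pd1 u z ^ 2 + pd2 u z ^ 2)

/-- `u` is a solution of the minimal surface equation on the open set `U`. -/
def IsMSESolution (U : Set (ℝ × ℝ)) (u : ℝ × ℝ → ℝ) : Prop :=
  ContDiffOn ℝ 2 u U ∧ ∀ z ∈ U,
    (1 + pd2 u z ^ 2) * pd1 (pd1 u) z
      - 2 * pd1 u z * pd2 u z * pd2 (pd1 u) z
      + (1 + pd1 u z ^ 2) * pd2 (pd2 u) z = 0

open MeasureTheory Topology

/-- The quasilinear operator whose zeros are the solutions of the minimal surface equation. -/
noncomputable def mseOp (u : ℝ × ℝ → ℝ) (z : ℝ × ℝ) : ℝ :=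
  (1 + pd2 u z ^ 2) * pd1 (pd1 u) z
    - 2 * pd1 u z * pd2 u z * pd2 (pd1 u) z
    + (1 + pd1 u z ^ 2) * pd2 (pd2 u) z

lemma Wf_pos (u : ℝ × ℝ → ℝ) (z : ℝ × ℝ) : 0 < Wf u z :=
  Real.sqrt_pos.2 (by positivity)

lemma Wf_sq (u : ℝ × ℝ → ℝ) (z : ℝ × ℝ) : Wf u z ^ 2 = 1 + pd1 u z ^ 2 + pd2 u z ^ 2 :=
  Real.sq_sqrt (by positivity)

lemma abs_pd1_div_Wf_le_one (u : ℝ × ℝ → ℝ) (z : ℝ × ℝ) : |pd1 u z / Wf u z| ≤ 1 := by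
  rw [abs_div, abs_of_pos (Wf_pos u z), div_le_one (Wf_pos u z)]
  exact abs_le_of_sq_le_sq (by nlinarith [Wf_sq u z, sq_nonneg (pd2 u z)]) (Wf_pos u z).le

section Regularity

variable {U : Set (ℝ × ℝ)} {u : ℝ × ℝ → ℝ}

lemma contDiffOn_pd1 (hU : IsOpen U) (hu : ContDiffOn ℝ 2 u U) : ContDiffOn ℝ 1 (pd1 u) U :=
  (hu.fderiv_of_isOpen hU (by norm_num)).clm_apply contDiffOn_const

lemma contDiffOn_pd2 (hU : IsOpen U) (hu : ContDiffOn ℝ 2 u U) : ContDiffOn ℝ 1 (pd2 u) U :=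
  (hu.fderiv_of_isOpen hU (by norm_num)).clm_apply contDiffOn_const

lemma continuousOn_pd1 (hU : IsOpen U) (hu : ContDiffOn ℝ 1 u U) : ContinuousOn (pd1 u) U :=
  (hu.continuousOn_fderiv_of_isOpen hU le_rfl).clm_apply continuousOn_const

lemma continuousOn_pd2 (hU : IsOpen U) (hu : ContDiffOn ℝ 1 u U) : ContinuousOn (pd2 u) U :=
  (hu.continuousOn_fderiv_of_isOpen hU le_rfl).clm_apply continuousOn_const

lemma contDiffOn_Wf (hU : IsOpen U) (hu : ContDiffOn ℝ 2 u U) : ContDiffOn ℝ 1 (Wf u) U :=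
  ((contDiffOn_const.add ((contDiffOn_pd1 hU hu).pow 2)).add ((contDiffOn_pd2 hU hu).pow 2)).sqrt
    fun z _ => by positivity

lemma contDiffOn_pd1_div_Wf (hU : IsOpen U) (hu : ContDiffOn ℝ 2 u U) :
    ContDiffOn ℝ 1 (fun z => pd1 u z / Wf u z) U :=
  (contDiffOn_pd1 hU hu).div (contDiffOn_Wf hU hu) fun z _ => (Wf_pos u z).ne'

lemma contDiffOn_pd2_div_Wf (hU : IsOpen U) (hu : ContDiffOn ℝ 2 u U) :
    ContDiffOn ℝ 1 (fun z => pd2 u z / Wf u z) U :=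
  (contDiffOn_pd2 hU hu).div (contDiffOn_Wf hU hu) fun z _ => (Wf_pos u z).ne'

lemma continuousOn_mseOp (hU : IsOpen U) (hu : ContDiffOn ℝ 2 u U) :
    ContinuousOn (mseOp u) U := by
  have h1 := contDiffOn_pd1 hU hu
  have h2 := contDiffOn_pd2 hU hu
  have h11 := continuousOn_pd1 hU h1
  have h21 := continuousOn_pd2 hU h1
  have h22 := continuousOn_pd2 hU h2
  have c1 := h1.continuousOn
  have c2 := h2.continuousOn
  unfold mseOp
  fun_prop

lemma pd1_pd2_eq_pd2_pd1 (hU : IsOpen U) (hu : ContDiffOn ℝ 2 u U) {z : ℝ × ℝ} (hz : z ∈ U) :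
    pd1 (pd2 u) z = pd2 (pd1 u) z := by
  have hd : DifferentiableAt ℝ (fderiv ℝ u) z :=
    ((hu.fderiv_of_isOpen hU (m := 1) (by norm_num)).contDiffAt (hU.mem_nhds hz)).differentiableAt
      (by norm_num)
  have hs := ((hu.contDiffAt (hU.mem_nhds hz)).isSymmSndFDerivAt (by simp)) (1, 0) (0, 1)
  have key (v : ℝ × ℝ) : fderiv ℝ (fun y => fderiv ℝ u y v) z
      = (fderiv ℝ (fderiv ℝ u) z).flip v := by
    rw [fderiv_clm_apply hd (differentiableAt_const _)]
    simp
  change fderiv ℝ (fun y => fderiv ℝ u y (0, 1)) z (1, 0)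
    = fderiv ℝ (fun y => fderiv ℝ u y (1, 0)) z (0, 1)
  rw [key, key]
  exact hs

end Regularity

lemma hasFDerivAt_div_sqrt {p q : ℝ × ℝ → ℝ} {P R : ℝ × ℝ →L[ℝ] ℝ} {z : ℝ × ℝ}
    (hp : HasFDerivAt p P z) (hq : HasFDerivAt q R z) :
    HasFDerivAt (fun z => p z / Real.sqrt (1 + p z ^ 2 + q z ^ 2))
      ((Real.sqrt (1 + p z ^ 2 + q z ^ 2) ^ 3)⁻¹ •
        ((1 + q z ^ 2) • P - (p z * q z) • R)) z := by
  have hpos : 0 < 1 + p z ^ 2 + q z ^ 2 := by positivity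
  have hW : HasFDerivAt (fun z => 1 + p z ^ 2 + q z ^ 2) ((2 * p z) • P + (2 * q z) • R) z := by
    refine (((hasFDerivAt_const (1 : ℝ) z).add (hp.pow 2)).add (hq.pow 2)).congr_fderiv ?_
    simp
  have h := hp.mul ((hasDerivAt_inv (Real.sqrt_pos.2 hpos).ne').comp_hasFDerivAt z
    (hW.sqrt hpos.ne'))
  refine h.congr_fderiv ?_
  have hs := Real.sq_sqrt hpos.le
  have hs0 := (Real.sqrt_pos.2 hpos).ne'
  simp only [Function.comp]
  set s := Real.sqrt (1 + p z ^ 2 + q z ^ 2)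
  refine ContinuousLinearMap.ext fun v => ?_
  simp only [one_div, mul_inv_rev, smul_add, neg_smul, smul_neg, add_apply,
    sub_apply, neg_apply, smul_apply,
    smul_eq_mul]
  field_simp
  rw [hs]
  ring

/-- The divergence of the normalized gradient is the minimal surface operator over `W ^ 3`. -/
lemma div_normalized_gradient {U : Set (ℝ × ℝ)} {u : ℝ × ℝ → ℝ} (hU : IsOpen U)
    (hu : ContDiffOn ℝ 2 u U) {z : ℝ × ℝ} (hz : z ∈ U) :
    pd1 (fun z => pd1 u z / Wf u z) z + pd2 (fun z => pd2 u z / Wf u z) z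
      = mseOp u z / Wf u z ^ 3 := by
  have h1 := (((contDiffOn_pd1 hU hu).contDiffAt (hU.mem_nhds hz)).differentiableAt
    (by norm_num)).hasFDerivAt
  have h2 := (((contDiffOn_pd2 hU hu).contDiffAt (hU.mem_nhds hz)).differentiableAt
    (by norm_num)).hasFDerivAt
  have e1 := (hasFDerivAt_div_sqrt h1 h2).fderiv
  have e2 := (hasFDerivAt_div_sqrt h2 h1).fderiv
  have hs := pd1_pd2_eq_pd2_pd1 hU hu hz
  have hc : ∀ z, Wf u z = Real.sqrt (1 + pd2 u z ^ 2 + pd1 u z ^ 2) := fun z => by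
    rw [Wf, add_right_comm]
  have hA : pd1 (fun z => pd1 u z / Wf u z) z = (Wf u z ^ 3)⁻¹ *
      ((1 + pd2 u z ^ 2) * pd1 (pd1 u) z - pd1 u z * pd2 u z * pd1 (pd2 u) z) := by
    change fderiv ℝ _ z (1, 0) = _
    unfold Wf
    rw [e1]
    simp [pd1]
  have hB : pd2 (fun z => pd2 u z / Wf u z) z = (Wf u z ^ 3)⁻¹ *
      ((1 + pd1 u z ^ 2) * pd2 (pd2 u) z - pd2 u z * pd1 u z * pd2 (pd1 u) z) := by
    simp only [hc]
    change fderiv ℝ _ z (0, 1) = _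
    rw [e2]
    simp [pd2]
  rw [hA, hB, hs, mseOp]
  ring

/-- Monotonicity of the map `(p, q) ↦ (p, q) / √(1 + p² + q²)`. -/
lemma normalized_gradient_monotone (w v : ℝ × ℝ → ℝ) (z : ℝ × ℝ) :
    0 ≤ (pd1 w z - pd1 v z) * (pd1 w z / Wf w z - pd1 v z / Wf v z)
      + (pd2 w z - pd2 v z) * (pd2 w z / Wf w z - pd2 v z / Wf v z) := by
  have hA := Wf_pos w z
  have hB := Wf_pos v z
  have hA2 := Wf_sq w z
  have hB2 := Wf_sq v z
  generalize Wf w z = A at *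
  generalize Wf v z = B at *
  generalize pd1 w z = p at *
  generalize pd2 w z = q at *
  generalize pd1 v z = r at *
  generalize pd2 v z = s at *
  have hCS : 1 + p * r + q * s ≤ A * B := by
    refine le_of_abs_le (abs_le_of_sq_le_sq ?_ (by positivity))
    rw [mul_pow, hA2, hB2]
    nlinarith [sq_nonneg (p - r), sq_nonneg (q - s), sq_nonneg (p * s - q * r)]
  have : (p - r) * (p / A - r / B) + (q - s) * (q / A - s / B)
      = (A + B) * (A * B - (1 + p * r + q * s)) / (A * B) := by
    field_simp
    linear_combination (-B) * hA2 - A * hB2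
  rw [this]
  have : 0 ≤ A * B - (1 + p * r + q * s) := by linarith
  positivity

lemma contDiff_smoothTransition_one : ContDiff ℝ 1 Real.smoothTransition := by
  exact_mod_cast Real.smoothTransition.contDiff (n := 1)

/-- Flux comparison on a rectangle: if `w ≤ v` on the left, bottom and top sides, then the
divergence of the normalized gradient of `w`, weighted by a cutoff of `w - v`, is controlled by
the flux of the difference of the normalized gradients through the right side. -/
lemma setIntegral_le_flux {U : Set (ℝ × ℝ)} (hU : IsOpen U) {w v : ℝ × ℝ → ℝ}
    (hw : ContDiffOn ℝ 2 w U) (hv : IsMSESolution U v) {a b c d : ℝ} (hab : a ≤ b) (hcd : c ≤ d)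
    (hbox : Icc (a, c) (b, d) ⊆ U) (hleft : ∀ y ∈ Icc c d, w (a, y) ≤ v (a, y))
    (hbot : ∀ x ∈ Icc a b, w (x, c) ≤ v (x, c)) (htop : ∀ x ∈ Icc a b, w (x, d) ≤ v (x, d)) :
    ∫ z in Icc (a, c) (b, d), Real.smoothTransition (w z - v z) * (mseOp w z / Wf w z ^ 3)
      ≤ ∫ y in c..d, Real.smoothTransition (w (b, y) - v (b, y)) *
          (pd1 w (b, y) / Wf w (b, y) - pd1 v (b, y) / Wf v (b, y)) := by
  set φ := Real.smoothTransition with hφ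
  have hφm : Monotone φ := Real.smoothTransition.monotone
  set A : ℝ × ℝ → ℝ := fun z => pd1 w z / Wf w z - pd1 v z / Wf v z with hA
  set B : ℝ × ℝ → ℝ := fun z => pd2 w z / Wf w z - pd2 v z / Wf v z with hB
  have hφd : ContDiff ℝ 1 φ := contDiff_smoothTransition_one
  have hwv : ContDiffOn ℝ 1 (fun z => w z - v z) U := (hw.sub hv.1).of_le (by norm_num)
  have hφc : ContDiffOn ℝ 1 (fun z => φ (w z - v z)) U := hφd.comp_contDiffOn hwv
  have hAc : ContDiffOn ℝ 1 A U :=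
    (contDiffOn_pd1_div_Wf hU hw).sub (contDiffOn_pd1_div_Wf hU hv.1)
  have hBc : ContDiffOn ℝ 1 B U :=
    (contDiffOn_pd2_div_Wf hU hw).sub (contDiffOn_pd2_div_Wf hU hv.1)
  have hF : ContDiffOn ℝ 1 (fun z => φ (w z - v z) * A z) U := hφc.mul hAc
  have hG : ContDiffOn ℝ 1 (fun z => φ (w z - v z) * B z) U := hφc.mul hBc
  have hdiff {f : ℝ × ℝ → ℝ} (hf : ContDiffOn ℝ 1 f U) {z} (hz : z ∈ U) : DifferentiableAt ℝ f z :=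
    (hf.contDiffAt (hU.mem_nhds hz)).differentiableAt (by norm_num)
  have hsub : Ioo a b ×ˢ Ioo c d ⊆ Icc (a, c) (b, d) := fun z hz =>
    ⟨⟨hz.1.1.le, hz.2.1.le⟩, ⟨hz.1.2.le, hz.2.2.le⟩⟩
  have hcompact : IsCompact (Icc (a, c) (b, d)) := isCompact_Icc
  have hdiv := integral_divergence_prod_Icc_of_hasFDerivAt_of_le
    (fun z => φ (w z - v z) * A z) (fun z => φ (w z - v z) * B z)
    (fderiv ℝ (fun z => φ (w z - v z) * A z)) (fderiv ℝ (fun z => φ (w z - v z) * B z))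
    (a, c) (b, d) ⟨hab, hcd⟩ (hF.continuousOn.mono hbox) (hG.continuousOn.mono hbox)
    (fun z hz => (hdiff hF (hbox (hsub hz))).hasFDerivAt)
    (fun z hz => (hdiff hG (hbox (hsub hz))).hasFDerivAt)
    (((continuousOn_pd1 hU hF).add (continuousOn_pd2 hU hG)).mono hbox
      |>.integrableOn_compact hcompact)
  have hzero {z : ℝ × ℝ} (h : w z ≤ v z) : φ (w z - v z) = 0 :=
    Real.smoothTransition.zero_of_nonpos (sub_nonpos.2 h)
  have hT : ∫ x in a..b, φ (w (x, d) - v (x, d)) * B (x, d) = 0 := by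
    rw [intervalIntegral.integral_congr (g := fun _ => 0), intervalIntegral.integral_zero]
    intro x hx
    rw [uIcc_of_le hab] at hx
    simp [hzero (htop x hx)]
  have hBo : ∫ x in a..b, φ (w (x, c) - v (x, c)) * B (x, c) = 0 := by
    rw [intervalIntegral.integral_congr (g := fun _ => 0), intervalIntegral.integral_zero]
    intro x hx
    rw [uIcc_of_le hab] at hx
    simp [hzero (hbot x hx)]
  have hL : ∫ y in c..d, φ (w (a, y) - v (a, y)) * A (a, y) = 0 := by
    rw [intervalIntegral.integral_congr (g := fun _ => 0), intervalIntegral.integral_zero]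
    intro y hy
    rw [uIcc_of_le hcd] at hy
    simp [hzero (hleft y hy)]
  simp only [hT, hBo, hL, sub_zero, zero_add] at hdiv
  rw [← hdiv]
  have hD : ContinuousOn (fun z => φ (w z - v z) * (mseOp w z / Wf w z ^ 3)) U :=
    hφc.continuousOn.mul ((continuousOn_mseOp hU hw).div
      ((contDiffOn_Wf hU hw).continuousOn.pow 3) fun z _ => (pow_pos (Wf_pos w z) 3).ne')
  refine setIntegral_mono_on ((hD.mono hbox).integrableOn_compact hcompact)
    (((continuousOn_pd1 hU hF).add (continuousOn_pd2 hU hG)).mono hbox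
      |>.integrableOn_compact hcompact) measurableSet_Icc fun z hz => ?_
  have hzU := hbox hz
  have hw1 := hdiff (hw.of_le (by norm_num)) hzU
  have hv1 := hdiff (hv.1.of_le (by norm_num)) hzU
  have hφ' : HasFDerivAt (fun z => φ (w z - v z))
      (deriv φ (w z - v z) • (fderiv ℝ w z - fderiv ℝ v z)) z :=
    ((hφd.differentiable (by norm_num)) _).hasDerivAt.comp_hasFDerivAt z
      (hw1.hasFDerivAt.sub hv1.hasFDerivAt)
  have hFd := (hφ'.mul (hdiff hAc hzU).hasFDerivAt).fderiv
  have hGd := (hφ'.mul (hdiff hBc hzU).hasFDerivAt).fderiv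
  have hA1 : fderiv ℝ A z (1, 0) = pd1 (fun z => pd1 w z / Wf w z) z
      - pd1 (fun z => pd1 v z / Wf v z) z := by
    have := ((hdiff (contDiffOn_pd1_div_Wf hU hw) hzU).hasFDerivAt.sub
      (hdiff (contDiffOn_pd1_div_Wf hU hv.1) hzU).hasFDerivAt).fderiv
    exact congrArg (fun L : ℝ × ℝ →L[ℝ] ℝ => L (1, 0)) this
  have hB1 : fderiv ℝ B z (0, 1) = pd2 (fun z => pd2 w z / Wf w z) z
      - pd2 (fun z => pd2 v z / Wf v z) z := by
    have := ((hdiff (contDiffOn_pd2_div_Wf hU hw) hzU).hasFDerivAt.sub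
      (hdiff (contDiffOn_pd2_div_Wf hU hv.1) hzU).hasFDerivAt).fderiv
    exact congrArg (fun L : ℝ × ℝ →L[ℝ] ℝ => L (0, 1)) this
  have hwdiv := div_normalized_gradient hU hw hzU
  have hvdiv := div_normalized_gradient hU hv.1 hzU
  rw [show mseOp v z = 0 from hv.2 z hzU, zero_div] at hvdiv
  have hmono := normalized_gradient_monotone w v z
  have hφ0 : 0 ≤ deriv φ (w z - v z) := hφm.deriv_nonneg
  have e1 : fderiv ℝ (fun z => φ (w z - v z) * A z) z (1, 0)
      = φ (w z - v z) * fderiv ℝ A z (1, 0)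
        + A z * (deriv φ (w z - v z) * (pd1 w z - pd1 v z)) :=
    congrArg (fun L : ℝ × ℝ →L[ℝ] ℝ => L (1, 0)) hFd
  have e2 : fderiv ℝ (fun z => φ (w z - v z) * B z) z (0, 1)
      = φ (w z - v z) * fderiv ℝ B z (0, 1)
        + B z * (deriv φ (w z - v z) * (pd2 w z - pd2 v z)) :=
    congrArg (fun L : ℝ × ℝ →L[ℝ] ℝ => L (0, 1)) hGd
  have e : fderiv ℝ (fun z => φ (w z - v z) * A z) z (1, 0)
      + fderiv ℝ (fun z => φ (w z - v z) * B z) z (0, 1)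
      = φ (w z - v z) * (mseOp w z / Wf w z ^ 3) + deriv φ (w z - v z) *
        ((pd1 w z - pd1 v z) * (pd1 w z / Wf w z - pd1 v z / Wf v z)
      + (pd2 w z - pd2 v z) * (pd2 w z / Wf w z - pd2 v z / Wf v z)) := by
    rw [e1, e2, hA1, hB1]
    linear_combination (φ (w z - v z)) * (hwdiv - hvdiv)
  rw [e]
  exact le_add_of_nonneg_right (mul_nonneg hφ0 hmono)

/-- A strict subsolution (for `α < β`) modelled on Scherk's surface. -/
noncomputable def scherk (α β a y₀ C : ℝ) (z : ℝ × ℝ) : ℝ :=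
  -(Real.log (Real.cos (β * (z.1 - a))) / β) + Real.log (Real.cos (α * (z.2 - y₀))) / α - C

/-- The domain of smoothness of `scherk`. -/
def scherkDomain (α β a y₀ : ℝ) : Set (ℝ × ℝ) :=
  {z | 0 < Real.cos (β * (z.1 - a)) ∧ 0 < Real.cos (α * (z.2 - y₀))}

section Scherk

variable {α β a y₀ C : ℝ}

lemma isOpen_scherkDomain : IsOpen (scherkDomain α β a y₀) :=
  (isOpen_lt (f := fun _ : ℝ × ℝ => (0 : ℝ)) (g := fun z => Real.cos (β * (z.1 - a)))
    continuous_const (by fun_prop)).inter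
  (isOpen_lt (f := fun _ : ℝ × ℝ => (0 : ℝ)) (g := fun z => Real.cos (α * (z.2 - y₀)))
    continuous_const (by fun_prop))

lemma contDiffOn_scherk : ContDiffOn ℝ 2 (scherk α β a y₀ C) (scherkDomain α β a y₀) := by
  have h1 : ContDiffOn ℝ 2 (fun z : ℝ × ℝ => Real.log (Real.cos (β * (z.1 - a))))
      (scherkDomain α β a y₀) := ContDiffOn.log (by fun_prop) fun z hz => hz.1.ne'
  have h2 : ContDiffOn ℝ 2 (fun z : ℝ × ℝ => Real.log (Real.cos (α * (z.2 - y₀))))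
      (scherkDomain α β a y₀) := ContDiffOn.log (by fun_prop) fun z hz => hz.2.ne'
  exact ((h1.div_const β).neg.add (h2.div_const α)).sub contDiffOn_const

lemma hasFDerivAt_scherk (hα : α ≠ 0) (hβ : β ≠ 0) {z : ℝ × ℝ} (hz : z ∈ scherkDomain α β a y₀) :
    HasFDerivAt (scherk α β a y₀ C)
      (Real.tan (β * (z.1 - a)) • ContinuousLinearMap.fst ℝ ℝ ℝ
        + (-Real.tan (α * (z.2 - y₀))) • ContinuousLinearMap.snd ℝ ℝ ℝ) z := by
  have key (γ s t : ℝ) (hγ : γ ≠ 0) (h : 0 < Real.cos (γ * (t - s))) :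
      HasDerivAt (fun t => Real.log (Real.cos (γ * (t - s))) / γ) (-Real.tan (γ * (t - s))) t := by
    have := (((((hasDerivAt_id t).sub_const s).const_mul γ).cos.log h.ne').div_const γ)
    refine this.congr_deriv ?_
    rw [Real.tan_eq_sin_div_cos]
    simp only [id]
    field_simp
  have h1 := (key β a z.1 hβ hz.1).comp_hasFDerivAt z (hasFDerivAt_fst (𝕜 := ℝ))
  have h2 := (key α y₀ z.2 hα hz.2).comp_hasFDerivAt z (hasFDerivAt_snd (𝕜 := ℝ))
  refine ((h1.neg.add h2).sub_const C).congr_fderiv ?_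
  rw [neg_smul (Real.tan (β * (z.1 - a))), neg_neg]

lemma pd1_scherk (hα : α ≠ 0) (hβ : β ≠ 0) {z : ℝ × ℝ} (hz : z ∈ scherkDomain α β a y₀) :
    pd1 (scherk α β a y₀ C) z = Real.tan (β * (z.1 - a)) := by
  rw [pd1, (hasFDerivAt_scherk hα hβ hz).fderiv]
  simp

lemma pd2_scherk (hα : α ≠ 0) (hβ : β ≠ 0) {z : ℝ × ℝ} (hz : z ∈ scherkDomain α β a y₀) :
    pd2 (scherk α β a y₀ C) z = -Real.tan (α * (z.2 - y₀)) := by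
  rw [pd2, (hasFDerivAt_scherk hα hβ hz).fderiv]
  simp

lemma mseOp_scherk (hα : α ≠ 0) (hβ : β ≠ 0) {z : ℝ × ℝ} (hz : z ∈ scherkDomain α β a y₀) :
    mseOp (scherk α β a y₀ C) z
      = (β - α) * (1 + Real.tan (β * (z.1 - a)) ^ 2) * (1 + Real.tan (α * (z.2 - y₀)) ^ 2) := by
  have key (γ s t : ℝ) (h : 0 < Real.cos (γ * (t - s))) :
      HasDerivAt (fun t => Real.tan (γ * (t - s))) (γ * (1 + Real.tan (γ * (t - s)) ^ 2)) t := by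
    have := (Real.hasDerivAt_tan h.ne').comp t (((hasDerivAt_id t).sub_const s).const_mul γ)
    refine this.congr_deriv ?_
    rw [← Real.inv_one_add_tan_sq h.ne']
    simp
    ring
  have hnhds := isOpen_scherkDomain.mem_nhds hz
  have e1 : pd1 (scherk α β a y₀ C) =ᶠ[𝓝 z] fun z => Real.tan (β * (z.1 - a)) := by
    filter_upwards [hnhds] with x hx using pd1_scherk hα hβ hx
  have e2 : pd2 (scherk α β a y₀ C) =ᶠ[𝓝 z] fun z => -Real.tan (α * (z.2 - y₀)) := by
    filter_upwards [hnhds] with x hx using pd2_scherk hα hβ hx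
  have h1 := ((key β a z.1 hz.1).comp_hasFDerivAt z
    (hasFDerivAt_fst (𝕜 := ℝ))).congr_of_eventuallyEq e1 |>.fderiv
  have h2 := ((key α y₀ z.2 hz.2).comp_hasFDerivAt z
    (hasFDerivAt_snd (𝕜 := ℝ))).neg.congr_of_eventuallyEq e2 |>.fderiv
  have h11 : pd1 (pd1 (scherk α β a y₀ C)) z = β * (1 + Real.tan (β * (z.1 - a)) ^ 2) := by
    rw [pd1, h1]; simp
  have h21 : pd2 (pd1 (scherk α β a y₀ C)) z = 0 := by
    rw [pd2, h1]; simp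
  have h22 : pd2 (pd2 (scherk α β a y₀ C)) z = -(α * (1 + Real.tan (α * (z.2 - y₀)) ^ 2)) := by
    rw [pd2, h2]; simp
  rw [mseOp, h11, h21, h22, pd1_scherk hα hβ hz, pd2_scherk hα hβ hz]
  ring

lemma mseOp_scherk_pos (hα : 0 < α) (hαβ : α < β) {z : ℝ × ℝ} (hz : z ∈ scherkDomain α β a y₀) :
    0 < mseOp (scherk α β a y₀ C) z := by
  rw [mseOp_scherk hα.ne' (hα.trans hαβ).ne' hz]
  have := sub_pos.2 hαβ
  positivity

lemma scherk_le (hβ : 0 < β) {b : ℝ} (hb : β * (b - a) < π / 2) {z : ℝ × ℝ}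
    (hz : z.1 ∈ Icc a b) :
    scherk α β a y₀ C z ≤ -(Real.log (Real.cos (β * (b - a))) / β)
      + Real.log (Real.cos (α * (z.2 - y₀))) / α - C := by
  have h0 : 0 ≤ β * (z.1 - a) := mul_nonneg hβ.le (sub_nonneg.2 hz.1)
  have h1 : β * (z.1 - a) ≤ β * (b - a) :=
    mul_le_mul_of_nonneg_left (sub_le_sub_right hz.2 a) hβ.le
  have hpos : 0 < Real.cos (β * (b - a)) :=
    Real.cos_pos_of_mem_Ioo ⟨by linarith [Real.pi_pos], hb⟩
  have hcos : Real.cos (β * (b - a)) ≤ Real.cos (β * (z.1 - a)) :=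
    Real.cos_le_cos_of_nonneg_of_le_pi h0 (by linarith [Real.pi_pos]) h1
  have := div_le_div_of_nonneg_right (Real.log_le_log hpos hcos) hβ.le
  unfold scherk
  linarith

lemma mem_scherkDomain (hα : 0 < α) (hβ : 0 < β) {b η : ℝ} (hb : β * (b - a) < π / 2)
    (hη : α * η = π / 2) {z : ℝ × ℝ} (hz₁ : z.1 ∈ Icc a b) (hz₂ : |z.2 - y₀| < η) :
    z ∈ scherkDomain α β a y₀ := by
  have h0 : 0 ≤ β * (z.1 - a) := mul_nonneg hβ.le (sub_nonneg.2 hz₁.1)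
  have h1 : β * (z.1 - a) ≤ β * (b - a) :=
    mul_le_mul_of_nonneg_left (sub_le_sub_right hz₁.2 a) hβ.le
  refine ⟨Real.cos_pos_of_mem_Ioo ⟨by linarith [Real.pi_pos], by linarith⟩,
    Real.cos_pos_of_mem_Ioo ?_⟩
  have h2 := mul_lt_mul_of_pos_left hz₂ hα
  rw [hη, ← abs_of_pos hα, ← abs_mul] at h2
  simpa only [abs_of_pos hα, mem_Ioo] using abs_lt.1 h2

end Scherk

/-- Flux estimate for the cutoff of `w - v` on a rectangle whose horizontal sides are the lines
where the Scherk-type subsolution `w` tends to `-∞`. -/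
lemma setIntegral_scherk_le {Ω : Set (ℝ × ℝ)} (hΩ : IsOpen Ω) {v : ℝ × ℝ → ℝ}
    (hv : IsMSESolution Ω v) {α β a b y₀ η C : ℝ} (hα : 0 < α) (hαβ : α < β) (hab : a ≤ b)
    (hb : β * (b - a) < π / 2) (hη : α * η = π / 2)
    (hsub : Icc a b ×ˢ Icc (y₀ - η) (y₀ + η) ⊆ Ω)
    (hleft : ∀ y ∈ Icc (y₀ - η) (y₀ + η), -C ≤ v (a, y)) {η' : ℝ} (hη' : η' < η)
    {K : Set (ℝ × ℝ)} (hK : K ⊆ Icc a b ×ˢ Icc (y₀ - η') (y₀ + η')) {B : ℝ → ℝ}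
    (hBc : ContinuousOn B (Icc (y₀ - η) (y₀ + η)))
    (hB0 : ∀ y ∈ Icc (y₀ - η) (y₀ + η), 0 ≤ B y)
    (hB : ∀ y ∈ Ioo (y₀ - η) (y₀ + η),
      Real.smoothTransition (scherk α β a y₀ C (b, y) - v (b, y)) *
        (pd1 (scherk α β a y₀ C) (b, y) / Wf (scherk α β a y₀ C) (b, y)
          - pd1 v (b, y) / Wf v (b, y)) ≤ B y) :
    ∫ z in K, Real.smoothTransition (scherk α β a y₀ C z - v z) *
        (mseOp (scherk α β a y₀ C) z / Wf (scherk α β a y₀ C) z ^ 3)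
      ≤ ∫ y in (y₀ - η)..(y₀ + η), B y := by
  have hβ : 0 < β := hα.trans hαβ
  have hη0 : 0 < η := by
    by_contra! h
    nlinarith [Real.pi_pos]
  set w := scherk α β a y₀ C with hw
  obtain ⟨M, hM⟩ : ∃ M, ∀ z ∈ Icc a b ×ˢ Icc (y₀ - η) (y₀ + η), M ≤ v z := by
    obtain ⟨M, hM⟩ := (isCompact_Icc.prod isCompact_Icc).bddBelow_image
      (hv.1.continuousOn.mono hsub)
    exact ⟨M, fun z hz => hM (mem_image_of_mem v hz)⟩
  obtain ⟨r, hr0, hr', hrη, hr⟩ : ∃ r, 0 < r ∧ η' < r ∧ r < η ∧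
      -(Real.log (Real.cos (β * (b - a))) / β) + Real.log (Real.cos (α * r)) / α - C ≤ M := by
    have h1 : Tendsto (fun t => α * t) (𝓝[<] η) (𝓝[<] (π / 2)) := by
      refine tendsto_nhdsWithin_iff.2 ⟨?_, ?_⟩
      · rw [← hη]
        exact ((continuous_const.mul continuous_id).tendsto η).mono_left nhdsWithin_le_nhds
      · filter_upwards [self_mem_nhdsWithin] with t ht
        rw [mem_Iio, ← hη]
        exact mul_lt_mul_of_pos_left ht hα
    have h2 := ((Real.tendsto_log_nhdsGT_zero.comp Real.tendsto_cos_pi_div_two).comp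
      h1).atBot_div_const hα
    obtain ⟨r, ⟨hr1, hr2⟩, hr3⟩ := (Filter.Eventually.and
      (Ioo_mem_nhdsLT (max_lt hη0 hη')) (h2.eventually_le_atBot
        (M + C + Real.log (Real.cos (β * (b - a))) / β))).exists
    refine ⟨r, (le_max_left _ _).trans_lt hr1, (le_max_right _ _).trans_lt hr1, hr2, ?_⟩
    simp only [Function.comp] at hr3
    linarith
  have hcosr : 0 < Real.cos (α * r) := by
    have := mul_lt_mul_of_pos_left hrη hα
    exact Real.cos_pos_of_mem_Ioo ⟨by nlinarith [Real.pi_pos], by linarith⟩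
  set U := scherkDomain α β a y₀ ∩ Ω with hU
  have hUo : IsOpen U := isOpen_scherkDomain.inter hΩ
  have hboxη : Icc (a, y₀ - r) (b, y₀ + r) ⊆ Icc a b ×ˢ Icc (y₀ - η) (y₀ + η) := by
    rintro z ⟨⟨h1, h2⟩, h3, h4⟩
    simp only at h1 h2 h3 h4
    exact ⟨⟨h1, h3⟩, by linarith, by linarith⟩
  have hbox : Icc (a, y₀ - r) (b, y₀ + r) ⊆ U := by
    refine fun z hz => ⟨mem_scherkDomain hα hβ hb hη ?_ ?_, hsub (hboxη hz)⟩
    · exact (hboxη hz).1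
    · obtain ⟨⟨h1, h2⟩, h3, h4⟩ := hz
      simp only at h1 h2 h3 h4
      exact abs_lt.2 ⟨by linarith, by linarith⟩
  have hwU : ContDiffOn ℝ 2 w U := contDiffOn_scherk.mono inter_subset_left
  have hvU : IsMSESolution U v :=
    ⟨hv.1.mono inter_subset_right, fun z hz => hv.2 z hz.2⟩
  have hside (x : ℝ) (hx : x ∈ Icc a b) (y : ℝ) (hy : y ∈ Icc (y₀ - η) (y₀ + η))
      (hyr : Real.cos (α * (y - y₀)) = Real.cos (α * r)) : w (x, y) ≤ v (x, y) := by
    refine (scherk_le hβ hb (z := (x, y)) hx).trans (le_trans ?_ (hM (x, y) ⟨hx, hy⟩))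
    simpa only [hyr] using hr
  have hcd : y₀ - r ≤ y₀ + r := by linarith
  have hflux := setIntegral_le_flux hUo hwU hvU hab hcd hbox
    (fun y hy => by
      have hyU := (hbox (show (a, y) ∈ Icc (a, y₀ - r) (b, y₀ + r) from
        ⟨⟨le_rfl, hy.1⟩, ⟨hab, hy.2⟩⟩)).1.2
      refine le_trans ?_ (hleft y ⟨by linarith [hy.1], by linarith [hy.2]⟩)
      have := div_nonpos_of_nonpos_of_nonneg
        (Real.log_nonpos hyU.le (Real.cos_le_one _)) hα.le
      simp only [hw, scherk, sub_self, mul_zero, Real.cos_zero, Real.log_one, zero_div, neg_zero,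
        zero_add]
      simp only at this
      linarith)
    (fun x hx => hside x hx _ ⟨by linarith, by linarith⟩ (by
      rw [← Real.cos_neg]; congr 1; ring))
    (fun x hx => hside x hx _ ⟨by linarith, by linarith⟩ (by congr 1; ring))
  have hDpos : ∀ z ∈ Icc (a, y₀ - r) (b, y₀ + r),
      0 ≤ Real.smoothTransition (w z - v z) * (mseOp w z / Wf w z ^ 3) := fun z hz =>
    mul_nonneg (Real.smoothTransition.nonneg _)
      (div_nonneg (mseOp_scherk_pos hα hαβ (hbox hz).1).le (pow_pos (Wf_pos w z) 3).le)
  have hwvc : ContinuousOn (fun z => Real.smoothTransition (w z - v z)) U :=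
    Real.smoothTransition.continuous.comp_continuousOn
      (hwU.continuousOn.sub hvU.1.continuousOn)
  have hDc : ContinuousOn
      (fun z => Real.smoothTransition (w z - v z) * (mseOp w z / Wf w z ^ 3)) U :=
    hwvc.mul ((continuousOn_mseOp hUo hwU).div ((contDiffOn_Wf hUo hwU).continuousOn.pow 3)
      fun z _ => (pow_pos (Wf_pos w z) 3).ne')
  have hKbox : K ⊆ Icc (a, y₀ - r) (b, y₀ + r) := fun z hz => by
    obtain ⟨⟨h1, h2⟩, h3, h4⟩ := hK hz
    exact ⟨⟨h1, by simp only; linarith⟩, ⟨h2, by simp only; linarith⟩⟩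
  refine (setIntegral_mono_set ((hDc.mono hbox).integrableOn_compact isCompact_Icc)
    ((ae_restrict_iff' measurableSet_Icc).2 (Eventually.of_forall hDpos))
    hKbox.eventuallyLE).trans (hflux.trans ?_)
  have hsubr : Icc (y₀ - r) (y₀ + r) ⊆ Icc (y₀ - η) (y₀ + η) :=
    Icc_subset_Icc (by linarith) (by linarith)
  have hBi : IntervalIntegrable B volume (y₀ - η) (y₀ + η) :=
    ContinuousOn.intervalIntegrable (by rwa [uIcc_of_le (by linarith)])
  have hBr : IntervalIntegrable B volume (y₀ - r) (y₀ + r) :=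
    ContinuousOn.intervalIntegrable (by rw [uIcc_of_le hcd]; exact hBc.mono hsubr)
  have hmaps : MapsTo (fun y : ℝ => (b, y)) (Icc (y₀ - r) (y₀ + r)) U := fun y hy =>
    hbox ⟨⟨hab, hy.1⟩, ⟨le_rfl, hy.2⟩⟩
  have hFc : ContinuousOn (fun z => Real.smoothTransition (w z - v z) *
      (pd1 w z / Wf w z - pd1 v z / Wf v z)) U :=
    hwvc.mul ((contDiffOn_pd1_div_Wf hUo hwU).sub
      (contDiffOn_pd1_div_Wf hUo hvU.1)).continuousOn
  refine (intervalIntegral.integral_mono_on hcd (ContinuousOn.intervalIntegrable ?_) hBr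
    fun y hy => hB y ⟨by linarith [hy.1], by linarith [hy.2]⟩).trans ?_
  · rw [uIcc_of_le hcd]
    exact hFc.comp (by fun_prop) hmaps
  · refine intervalIntegral.integral_mono_interval (by linarith) hcd (by linarith) ?_ hBi
    refine (ae_restrict_iff' measurableSet_Ioc).2 (Eventually.of_forall fun y hy => ?_)
    exact hB0 y ⟨hy.1.le, hy.2⟩

/-- If the integrals of the cutoff of `w - uₙ` tend to zero on compact sets, the limit of `uₙ` lies
above the strict subsolution `w`. -/
lemma scherk_le_of_tendstoUniformlyOn {S : Set (ℝ × ℝ)} (hS : IsOpen S) {α β a y₀ C : ℝ}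
    (hα : 0 < α) (hαβ : α < β) (hSd : S ⊆ scherkDomain α β a y₀) {u : ℕ → ℝ × ℝ → ℝ}
    {ulim : ℝ × ℝ → ℝ} (hu : ∀ n, ContinuousOn (u n) S) (hulim : ContinuousOn ulim S)
    (hconv : ∀ K ⊆ S, IsCompact K → TendstoUniformlyOn u ulim atTop K)
    (hest : ∃ e : ℕ → ℝ, Tendsto e atTop (𝓝 0) ∧ ∀ K ⊆ S, IsCompact K →
      ∀ᶠ n in atTop,
      ∫ z in K, Real.smoothTransition (scherk α β a y₀ C z - u n z) *
        (mseOp (scherk α β a y₀ C) z / Wf (scherk α β a y₀ C) z ^ 3) ≤ e n)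
    {z : ℝ × ℝ} (hz : z ∈ S) : scherk α β a y₀ C z ≤ ulim z := by
  obtain ⟨e, he, hest⟩ := hest
  set w := scherk α β a y₀ C with hw
  by_contra! hlt
  have hwd : ContDiffOn ℝ 2 w S := contDiffOn_scherk.mono hSd
  obtain ⟨δ, hδ, hδz⟩ : ∃ δ > 0, 2 * δ < w z - ulim z :=
    ⟨(w z - ulim z) / 3, by linarith, by linarith⟩
  have hcont : ContinuousAt (fun x => w x - ulim x) z :=
    (hwd.continuousOn.sub hulim).continuousAt (hS.mem_nhds hz)
  obtain ⟨r, hr, hball⟩ := Metric.nhds_basis_closedBall.mem_iff.1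
    (inter_mem (hS.mem_nhds hz) (hcont.eventually (lt_mem_nhds hδz)))
  have hKc : IsCompact (Metric.closedBall z r) := isCompact_closedBall z r
  have hKS : Metric.closedBall z r ⊆ S := fun x hx => (hball hx).1
  have hDc : ContinuousOn (fun z => mseOp w z / Wf w z ^ 3) S :=
    (continuousOn_mseOp hS hwd).div ((contDiffOn_Wf hS hwd).continuousOn.pow 3)
      fun z _ => (pow_pos (Wf_pos w z) 3).ne'
  obtain ⟨x₀, hx₀, hmin⟩ := hKc.exists_isMinOn ⟨z, Metric.mem_closedBall_self hr.le⟩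
    (hDc.mono hKS)
  have hm : 0 < mseOp w x₀ / Wf w x₀ ^ 3 :=
    div_pos (mseOp_scherk_pos hα hαβ (hSd (hKS hx₀))) (pow_pos (Wf_pos w x₀) 3)
  set c := Real.smoothTransition δ * (mseOp w x₀ / Wf w x₀ ^ 3) with hc
  have hcpos : 0 < c := mul_pos (Real.smoothTransition.pos_of_pos hδ) hm
  have hvol : 0 < volume.real (Metric.closedBall z r) :=
    ENNReal.toReal_pos (Metric.measure_closedBall_pos volume z hr).ne' hKc.measure_lt_top.ne
  have hlow : ∀ᶠ n in atTop, c * volume.real (Metric.closedBall z r) ≤ e n := by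
    filter_upwards [hest _ hKS hKc, Metric.tendstoUniformlyOn_iff.1 (hconv _ hKS hKc) δ hδ]
      with n hn hdist
    refine le_trans (setIntegral_ge_of_const_le_real hKc.measurableSet hKc.measure_lt_top.ne
      (fun x hx => ?_) ?_) hn
    · refine mul_le_mul (Real.smoothTransition.monotone ?_) (hmin hx) hm.le
        (Real.smoothTransition.nonneg _)
      have h1 := (abs_lt.1 (hdist x hx)).1
      have h2 : 2 * δ < w x - ulim x := (hball hx).2
      linarith
    · refine ContinuousOn.integrableOn_compact hKc (ContinuousOn.mono ?_ hKS)
      exact (Real.smoothTransition.continuous.comp_continuousOn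
        (hwd.continuousOn.sub (hu n))).mul hDc
  exact absurd (ge_of_tendsto he hlow) (not_le.2 (mul_pos hcpos hvol))

/-- Near the right side of the square, a function with boundary value `+∞` there is bounded below
by any constant, uniformly on compact subsets of the side. -/
lemma exists_forall_lt_of_tendsto_atTop {Q : Set (ℝ × ℝ)}
    (hQ : Q = Set.Ioo (0 : ℝ) 1 ×ˢ Set.Ioo (0 : ℝ) 1) {f : ℝ × ℝ → ℝ}
    (hf : ∀ y₀ ∈ Ioo (0 : ℝ) 1, Tendsto f (𝓝[Q] ((1 : ℝ), y₀)) atTop) {c d : ℝ}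
    (hcd : Icc c d ⊆ Ioo 0 1) {s : ℝ} (hs : s < 1) (M : ℝ) :
    ∃ b ∈ Ioo s 1, ∀ y ∈ Icc c d, M < f (b, y) := by
  have h := (isCompact_Icc (a := c) (b := d)).eventually_forall_of_forall_eventually (x₀ := (1 : ℝ))
    (P := fun x y => (x, y) ∈ Q → M < f (x, y)) fun y hy =>
      eventually_nhdsWithin_iff.1 ((hf y (hcd hy)).eventually_gt_atTop M)
  obtain ⟨b, hb, hb'⟩ := (((h.filter_mono nhdsWithin_le_nhds).and
    (Ioo_mem_nhdsLT (max_lt hs one_pos))) : ∀ᶠ x in 𝓝[<] (1 : ℝ), _).exists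
  refine ⟨b, ⟨(le_max_left _ _).trans_lt hb'.1, hb'.2⟩, fun y hy => hb y hy ?_⟩
  rw [hQ]
  exact ⟨⟨(le_max_right _ _).trans_lt hb'.1, hb'.2⟩, hcd hy⟩

/-- The flux deficit through the right side tends to zero when the normalized gradient converges
to the outward normal there. -/
lemma tendsto_integral_one_sub_flux {Ω : Set (ℝ × ℝ)} (hΩ : IsOpen Ω) {v : ℕ → ℝ × ℝ → ℝ}
    (hv : ∀ n, ContDiffOn ℝ 2 (v n) Ω) {b c d : ℝ} (hcd : c ≤ d)
    (hsub : ∀ y ∈ Icc c d, (b, y) ∈ Ω)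
    (hlim : ∀ y ∈ Icc c d,
      Tendsto (fun n => pd1 (v n) (b, y) / Wf (v n) (b, y)) atTop (𝓝 1)) :
    Tendsto (fun n => ∫ y in c..d, (1 - pd1 (v n) (b, y) / Wf (v n) (b, y))) atTop (𝓝 0) := by
  have hI : uIoc c d ⊆ Icc c d := by
    rw [uIoc_of_le hcd]
    exact Ioc_subset_Icc_self
  rw [show (0 : ℝ) = ∫ _ in c..d, (0 : ℝ) by simp]
  refine intervalIntegral.tendsto_integral_filter_of_dominated_convergence (fun _ => 2)
    (Eventually.of_forall fun n => ?_) (Eventually.of_forall fun n => ?_) (by simp) ?_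
  · refine ContinuousOn.aestronglyMeasurable ?_ measurableSet_uIoc
    exact continuousOn_const.sub ((contDiffOn_pd1_div_Wf hΩ (hv n)).continuousOn.comp
      (f := fun y : ℝ => (b, y)) (by fun_prop) fun y hy => hsub y (hI hy))
  · refine Eventually.of_forall fun y _ => ?_
    have := abs_le.1 (abs_pd1_div_Wf_le_one (v n) (b, y))
    rw [Real.norm_eq_abs, abs_le]
    constructor <;> linarith
  · refine Eventually.of_forall fun y hy => ?_
    simpa using (hlim y (hI hy)).const_sub 1

/-- **The limit of a locally convergent sequence of solutions of the MSE inherits the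
boundary value `+∞`** (Lemma `lemdiv2` of the paper): if `uₙ → u` together with first
derivatives, uniformly on compact subsets of the open unit square, and either every
`uₙ` blows up to `+∞` at each point `(1,y₀)` of the right edge, or every `uₙ` extends
to a solution `vₙ` on `(0,2)×(0,1)` whose downward normal at `(1,y)` converges to the
horizontal vector `(1,0,0)`, then `u` blows up to `+∞` at each point `(1,y₀)`. -/
theorem stmt_5 (Q : Set (ℝ × ℝ)) (hQ : Q = Set.Ioo (0 : ℝ) 1 ×ˢ Set.Ioo (0 : ℝ) 1)
    (u : ℕ → ℝ × ℝ → ℝ) (ulim : ℝ × ℝ → ℝ)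
    (hu : ∀ n, IsMSESolution Q (u n)) (hulim : IsMSESolution Q ulim)
    (hconv : ∀ K ⊆ Q, IsCompact K →
      TendstoUniformlyOn (fun n => u n) ulim atTop K ∧
      TendstoUniformlyOn (fun n => pd1 (u n)) (pd1 ulim) atTop K ∧
      TendstoUniformlyOn (fun n => pd2 (u n)) (pd2 ulim) atTop K)
    (hcase :
      (∀ n, ∀ y₀ ∈ Set.Ioo (0 : ℝ) 1,
        Tendsto (u n) (nhdsWithin ((1 : ℝ), y₀) Q) atTop) ∨
      (∃ v : ℕ → ℝ × ℝ → ℝ,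
        (∀ n, IsMSESolution (Set.Ioo (0 : ℝ) 2 ×ˢ Set.Ioo (0 : ℝ) 1) (v n)) ∧
        (∀ n, ∀ z ∈ Q, u n z = v n z) ∧
        ∀ y ∈ Set.Ioo (0 : ℝ) 1,
          Tendsto (fun n => pd1 (v n) ((1 : ℝ), y) / Wf (v n) ((1 : ℝ), y))
            atTop (nhds 1) ∧
          Tendsto (fun n => pd2 (v n) ((1 : ℝ), y) / Wf (v n) ((1 : ℝ), y))
            atTop (nhds 0) ∧
          Tendsto (fun n => 1 / Wf (v n) ((1 : ℝ), y)) atTop (nhds 0))) :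
    ∀ y₀ ∈ Set.Ioo (0 : ℝ) 1, Tendsto ulim (nhdsWithin ((1 : ℝ), y₀) Q) atTop := by
  intro y₀ hy₀
  have hQo : IsOpen Q := hQ ▸ isOpen_Ioo.prod isOpen_Ioo
  set η := min y₀ (1 - y₀) / 2 with hη
  have hη0 : 0 < η := half_pos (lt_min hy₀.1 (sub_pos.2 hy₀.2))
  have hη1 : 2 * η ≤ y₀ := by rw [hη]; linarith [min_le_left y₀ (1 - y₀)]
  have hη2 : 2 * η ≤ 1 - y₀ := by rw [hη]; linarith [min_le_right y₀ (1 - y₀)]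
  have hIcc : Icc (y₀ - η) (y₀ + η) ⊆ Ioo 0 1 := fun y hy =>
    ⟨by linarith [hy.1], by linarith [hy.2]⟩
  set a := 1 - η / 2 with ha
  have ha0 : 0 < a := by linarith
  have ha1 : a < 1 := by linarith
  have hαη : π / (2 * η) * η = π / 2 := by field_simp
  set α := π / (2 * η) with hα
  have hα0 : 0 < α := by positivity
  have hLQ : ({a} : Set ℝ) ×ˢ Icc (y₀ - η) (y₀ + η) ⊆ Q := by
    rintro ⟨x, y⟩ ⟨rfl : x = a, hy⟩
    rw [hQ]
    exact ⟨⟨ha0, ha1⟩, hIcc hy⟩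
  have hLc : IsCompact (({a} : Set ℝ) ×ˢ Icc (y₀ - η) (y₀ + η)) :=
    isCompact_singleton.prod isCompact_Icc
  obtain ⟨m, hm⟩ := hLc.bddBelow_image (hulim.1.continuousOn.mono hLQ)
  obtain ⟨C, hC⟩ : ∃ C : ℝ, ∀ᶠ n in atTop, ∀ y ∈ Icc (y₀ - η) (y₀ + η), -C ≤ u n (a, y) := by
    refine ⟨1 - m, ?_⟩
    filter_upwards [Metric.tendstoUniformlyOn_iff.1 (hconv _ hLQ hLc).1 1 one_pos] with n hn y hy
    have hmem : (a, y) ∈ ({a} : Set ℝ) ×ˢ Icc (y₀ - η) (y₀ + η) := ⟨rfl, hy⟩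
    have h1 := (abs_lt.1 (hn _ hmem)).2
    have h2 := hm (mem_image_of_mem ulim hmem)
    linarith
  have hlower : ∀ β, α < β → β * (1 - a) < π / 2 → ∀ z ∈ Ioo a 1 ×ˢ Ioo (y₀ - η) (y₀ + η),
      scherk α β a y₀ C z ≤ ulim z := by
    intro β hαβ hβ z hz
    have hβ0 : 0 < β := hα0.trans hαβ
    obtain ⟨b, hzb, hb1⟩ := exists_between hz.1.2
    have hzabs : |z.2 - y₀| < η := abs_lt.2 ⟨by linarith [hz.2.1], by linarith [hz.2.2]⟩
    obtain ⟨η', hzη, hη'⟩ := exists_between hzabs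
    set S := Ioo a b ×ˢ Ioo (y₀ - η') (y₀ + η') with hS
    have hzS : z ∈ S := ⟨⟨hz.1.1, hzb⟩, by linarith [(abs_lt.1 hzη).1],
      by linarith [(abs_lt.1 hzη).2]⟩
    have hSQ : S ⊆ Q := by
      rw [hQ]
      exact prod_mono (Ioo_subset_Ioo ha0.le hb1.le)
        (Ioo_subset_Icc_self.trans ((Icc_subset_Icc (by linarith) (by linarith)).trans hIcc))
    have hSI (b' : ℝ) (hb' : b ≤ b') : S ⊆ Icc a b' ×ˢ Icc (y₀ - η') (y₀ + η') :=
      prod_mono (Ioo_subset_Icc_self.trans (Icc_subset_Icc_right hb')) Ioo_subset_Icc_self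
    have hSd : S ⊆ scherkDomain α β a y₀ := fun x hx =>
      mem_scherkDomain hα0 hβ0 hβ hαη ⟨hx.1.1.le, (hx.1.2.trans hb1).le⟩
        (abs_lt.2 ⟨by linarith [hx.2.1], by linarith [hx.2.2]⟩)
    refine scherk_le_of_tendstoUniformlyOn (isOpen_Ioo.prod isOpen_Ioo) hα0 hαβ hSd
      (fun n => (hu n).1.continuousOn.mono hSQ) (hulim.1.continuousOn.mono hSQ)
      (fun K hK hKc => (hconv K (hK.trans hSQ) hKc).1) ?_ hzS
    rcases hcase with hblow | ⟨v, hv, huv, hnormal⟩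
    · refine ⟨fun _ => 0, tendsto_const_nhds, fun K hK _ => hC.mono fun n hn => ?_⟩
      obtain ⟨b', ⟨hbb', hb'1⟩, hb'⟩ := exists_forall_lt_of_tendsto_atTop hQ (hblow n) hIcc hb1
        (-(Real.log (Real.cos (β * (1 - a))) / β) - C)
      have hab' : a ≤ b' := (hz.1.1.trans (hzb.trans hbb')).le
      have hβ' : β * (b' - a) < π / 2 :=
        (mul_lt_mul_of_pos_left (sub_lt_sub_right hb'1 a) hβ0).trans hβ
      have hsub : Icc a b' ×ˢ Icc (y₀ - η) (y₀ + η) ⊆ Q := by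
        rw [hQ]
        exact prod_mono (Icc_subset_Ioo ha0 hb'1) hIcc
      have key := setIntegral_scherk_le hQo (hu n) hα0 hαβ hab' hβ' hαη hsub hn hη'
        (hK.trans (hSI b' hbb'.le)) (B := fun _ => 0) continuousOn_const (fun _ _ => le_rfl)
        fun y hy => by
          have hmem : (b', y) ∈ scherkDomain α β a y₀ :=
            mem_scherkDomain hα0 hβ0 hβ hαη ⟨hab', hb'1.le⟩
              (abs_lt.2 ⟨by linarith [hy.1], by linarith [hy.2]⟩)
          have h1 := scherk_le (α := α) (y₀ := y₀) (C := C) hβ0 hβ (z := (b', y)) ⟨hab', hb'1.le⟩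
          have h2 := div_nonpos_of_nonpos_of_nonneg
            (Real.log_nonpos hmem.2.le (Real.cos_le_one _)) hα0.le
          rw [Real.smoothTransition.zero_of_nonpos, zero_mul]
          linarith [hb' y ⟨hy.1.le, hy.2.le⟩]
      simpa using key
    · have hΩ : IsOpen (Ioo (0 : ℝ) 2 ×ˢ Ioo (0 : ℝ) 1) := isOpen_Ioo.prod isOpen_Ioo
      refine ⟨_, tendsto_integral_one_sub_flux hΩ (fun n => (hv n).1) (b := 1) (c := y₀ - η)
        (d := y₀ + η) (by linarith) (fun y hy => ⟨⟨one_pos, one_lt_two⟩, hIcc hy⟩)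
        (fun y hy => (hnormal y (hIcc hy)).1), fun K hK hKc => hC.mono fun n hn => ?_⟩
      have hsub : Icc a 1 ×ˢ Icc (y₀ - η) (y₀ + η) ⊆ Ioo (0 : ℝ) 2 ×ˢ Ioo (0 : ℝ) 1 :=
        prod_mono (Icc_subset_Ioo ha0 one_lt_two) hIcc
      have hpde := abs_pd1_div_Wf_le_one
      have key := setIntegral_scherk_le hΩ (hv n) hα0 hαβ ha1.le hβ hαη hsub
        (fun y hy => by
          rw [← huv n (a, y) (hLQ ⟨rfl, hy⟩)]
          exact hn y hy) hη' (hK.trans (hSI 1 hb1.le))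
        (B := fun y => 1 - pd1 (v n) (1, y) / Wf (v n) (1, y))
        (continuousOn_const.sub ((contDiffOn_pd1_div_Wf hΩ (hv n).1).continuousOn.comp
          (f := fun y : ℝ => ((1 : ℝ), y)) (by fun_prop)
          fun y hy => hsub ⟨⟨ha1.le, le_rfl⟩, hy⟩))
        (fun y _ => sub_nonneg.2 (abs_le.1 (hpde (v n) (1, y))).2)
        fun y _ => by
          have h0 := sub_nonneg.2 (abs_le.1 (hpde (v n) (1, y))).2
          have h1 := (abs_le.1 (hpde (scherk α β a y₀ C) (1, y))).2
          exact (mul_le_mul_of_nonneg_left (sub_le_sub_right h1 _)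
            (Real.smoothTransition.nonneg _)).trans
            (mul_le_of_le_one_left h0 (Real.smoothTransition.le_one _))
      refine le_of_eq_of_le (setIntegral_congr_fun hKc.measurableSet fun x hx => ?_) key
      simp only [huv n x (hSQ (hK hx))]
  rw [tendsto_atTop]
  intro M
  have hL : 1 - a = η / 2 := by rw [ha]; ring
  obtain ⟨t, ⟨ht1, ht2⟩, ht⟩ : ∃ t, t ∈ Ioo (π / 4) (π / 2) ∧
      M + C < -Real.log (Real.cos t) * ((η / 2) / t) := by
    have h1 : Tendsto (fun t => -Real.log (Real.cos t)) (𝓝[<] (π / 2)) atTop :=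
      tendsto_neg_atBot_atTop.comp
        (Real.tendsto_log_nhdsGT_zero.comp Real.tendsto_cos_pi_div_two)
    have h2 : Tendsto (fun t => (η / 2) / t) (𝓝[<] (π / 2)) (𝓝 ((η / 2) / (π / 2))) :=
      (tendsto_const_nhds.div tendsto_id (by positivity)).mono_left nhdsWithin_le_nhds
    have h3 := h1.atTop_mul_pos (by positivity) h2
    exact (Filter.Eventually.and (Ioo_mem_nhdsLT (by linarith [Real.pi_pos]))
      (h3.eventually_gt_atTop (M + C))).exists
  set β := t / (η / 2) with hβ
  have ht0 : 0 < t := lt_trans (by positivity) ht1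
  have hβ0 : 0 < β := by positivity
  have hβt : β * (1 - a) = t := by rw [hL, hβ]; field_simp
  have hαβ : α < β := by
    rw [hα, hβ, div_lt_div_iff₀ (by positivity) (by positivity)]
    nlinarith
  have hmem : ((1 : ℝ), y₀) ∈ scherkDomain α β a y₀ :=
    mem_scherkDomain hα0 hβ0 (by rw [hβt]; exact ht2) hαη ⟨ha1.le, le_rfl⟩ (by simpa using hη0)
  have hval : M < scherk α β a y₀ C ((1 : ℝ), y₀) := by
    have : -(Real.log (Real.cos t) / β) = -Real.log (Real.cos t) * ((η / 2) / t) := by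
      rw [hβ]; field_simp
    simp only [scherk, hβt, sub_self, mul_zero, Real.cos_zero, Real.log_one, zero_div, add_zero]
    linarith
  have hcont := contDiffOn_scherk (C := C) |>.continuousOn.continuousAt
    (isOpen_scherkDomain.mem_nhds hmem)
  have hnhds : Ioi a ×ˢ Ioo (y₀ - η) (y₀ + η) ∈ 𝓝 ((1 : ℝ), y₀) :=
    (isOpen_Ioi.prod isOpen_Ioo).mem_nhds ⟨ha1, by linarith, by linarith⟩
  filter_upwards [nhdsWithin_le_nhds (hcont.eventually (lt_mem_nhds hval)),
    nhdsWithin_le_nhds hnhds, self_mem_nhdsWithin] with z hz1 hz2 hz3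
  rw [hQ] at hz3
  exact hz1.le.trans (hlower β hαβ (by rw [hβt]; exact ht2) z ⟨⟨hz2.1, hz3.1.2⟩, hz2.2⟩)
end

section
/- A strictly convex curve parametrized by its normal over an interval of directions contained in an open half-circle is a graph: Let I ⊆ ℝ be an interval, let c : I → ℝ² be a strictly convex curve parametrized by its normal, and let β₀ ∈ ℝ be such that I ⊆ (β₀ + π/2, β₀ + 3π/2). Then the function β ↦ ⟨c(β), (cos β₀, sin β₀)⟩ is strictly monotone on I; in particular c is injective and its image is the graph of a function over the line ℝ·(cos β₀, sin β₀) (i.e. over the line {(x,y) : y cos β₀ − x sin β₀ = 0}). -/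
open Real Filter Set

/-- A strictly convex curve parametrized by its normal on the set `I ⊆ ℝ`:
a `C¹` curve `c` with `c'(t) = r(t)·(cos t, sin t)` for a continuous positive
function `r`; the unit normal of `c` at `c(t)` is then `(sin t, −cos t)`. -/
def IsStrictConvexNormalParam (I : Set ℝ) (c : ℝ → ℝ × ℝ) : Prop :=
  ∃ r : ℝ → ℝ, ContinuousOn r I ∧ (∀ t ∈ I, 0 < r t) ∧
    ∀ t ∈ I, HasDerivWithinAt c (r t • ((Real.cos t, Real.sin t) : ℝ × ℝ)) I t

/-- **A strictly convex curve parametrized by its normal over directions contained in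
an open half-circle is a graph** (Proposition `convgraph` of the paper): if
`I ⊆ (β₀ + π/2, β₀ + 3π/2)`, then the tangential coordinate
`β ↦ ⟨c(β), (cos β₀, sin β₀)⟩` is strictly monotone on `I`; in particular `c` is
injective on `I` and its image is the graph of a function over the line
`ℝ·(cos β₀, sin β₀)`. -/
theorem stmt_6 (I : Set ℝ) (hI : I.OrdConnected) (c : ℝ → ℝ × ℝ)
    (hc : IsStrictConvexNormalParam I c) (β₀ : ℝ)
    (hsub : I ⊆ Set.Ioo (β₀ + π / 2) (β₀ + 3 * π / 2)) :
    (StrictMonoOn (fun β => (c β).1 * Real.cos β₀ + (c β).2 * Real.sin β₀) I ∨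
      StrictAntiOn (fun β => (c β).1 * Real.cos β₀ + (c β).2 * Real.sin β₀) I) ∧
    Set.InjOn c I ∧
    ∃ g : ℝ → ℝ, ∀ t ∈ I,
      (c t).1 * (-Real.sin β₀) + (c t).2 * Real.cos β₀ =
        g ((c t).1 * Real.cos β₀ + (c t).2 * Real.sin β₀) := by
  obtain ⟨r, -, hr, hd⟩ := hc
  have hderiv : ∀ t ∈ I, HasDerivWithinAt
      (fun β => (c β).1 * Real.cos β₀ + (c β).2 * Real.sin β₀)
      (r t * Real.cos (t - β₀)) I t := by
    intro t ht
    have h₁ : HasDerivWithinAt (fun β => (c β).1) (r t * Real.cos t) I t :=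
      (ContinuousLinearMap.fst ℝ ℝ ℝ).hasFDerivAt.comp_hasDerivWithinAt t (hd t ht)
    have h₂ : HasDerivWithinAt (fun β => (c β).2) (r t * Real.sin t) I t :=
      (ContinuousLinearMap.snd ℝ ℝ ℝ).hasFDerivAt.comp_hasDerivWithinAt t (hd t ht)
    refine ((h₁.mul_const _).add (h₂.mul_const _)).congr_deriv ?_
    rw [Real.cos_sub]
    ring
  have hanti : StrictAntiOn
      (fun β => (c β).1 * Real.cos β₀ + (c β).2 * Real.sin β₀) I := by
    refine strictAntiOn_of_hasDerivWithinAt_neg hI.convex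
      (fun t ht => (hderiv t ht).continuousWithinAt)
      (fun t ht => (hderiv t (interior_subset ht)).mono interior_subset) ?_
    intro t ht
    have htI := interior_subset ht
    obtain ⟨hl, hu⟩ := hsub htI
    exact mul_neg_of_pos_of_neg (hr t htI)
      (Real.cos_neg_of_pi_div_two_lt_of_lt (by linarith) (by linarith))
  refine ⟨Or.inr hanti, fun s hs t ht hst => hanti.injOn hs ht (by simp only [hst]), ?_⟩
  refine ⟨fun x => (c (Function.invFunOn
      (fun β => (c β).1 * Real.cos β₀ + (c β).2 * Real.sin β₀) I x)).1 * (-Real.sin β₀) +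
    (c (Function.invFunOn
      (fun β => (c β).1 * Real.cos β₀ + (c β).2 * Real.sin β₀) I x)).2 * Real.cos β₀, ?_⟩
  intro t ht
  have hinv := hanti.injOn.leftInvOn_invFunOn ht
  simp only [hinv]
end

section
/- A strictly convex curve parametrized by its normal stays in an angular sector determined by its initial tangent: Let θ ∈ ℝ, let 0 < β ≤ π/2 and ε > 0, and let c : (θ − ε, θ + β] → ℝ² be a strictly convex curve parametrized by its normal. Then for every t ∈ [θ, θ + β] there exist λ ≥ 0 and φ ∈ [θ, θ + β] such that c(t) = c(θ) + λ·(cos φ, sin φ); that is, c([θ, θ+β]) is contained in the closed angular sector of angle β with vertex c(θ) delimited by the two half-lines emanating from c(θ) in the directions (cos θ, sin θ) and (cos(θ+β), sin(θ+β)). -/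
open Real Filter Set

/-- A linear functional `(x, y) ↦ a x + b y` that is nonnegative on the tangent directions
`(cos s, sin s)`, `s ∈ [u, v]`, is monotone along the curve. -/
theorem IsStrictConvexNormalParam.monotoneOn_functional {I : Set ℝ} {c : ℝ → ℝ × ℝ}
    (hc : IsStrictConvexNormalParam I c) {u v : ℝ} (hI : Icc u v ⊆ I) (a b : ℝ)
    (hab : ∀ s ∈ Icc u v, 0 ≤ a * Real.cos s + b * Real.sin s) :
    MonotoneOn (fun s => a * (c s).1 + b * (c s).2) (Icc u v) := by
  obtain ⟨r, -, hr, hd⟩ := hc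
  have key : ∀ s ∈ Icc u v, HasDerivWithinAt (fun s => a * (c s).1 + b * (c s).2)
      (a * (r s * Real.cos s) + b * (r s * Real.sin s)) (Icc u v) s := by
    intro s hs
    have h := ((hd s (hI hs)).mono hI).hasFDerivWithinAt
    have h1 := h.fst.hasDerivWithinAt
    have h2 := h.snd.hasDerivWithinAt
    exact ((h1.const_mul a).add (h2.const_mul b)).congr_deriv (by simp)
  refine monotoneOn_of_hasDerivWithinAt_nonneg (convex_Icc u v)
    (fun s hs => (key s hs).continuousWithinAt)
    (fun s hs => (key s (interior_subset hs)).mono interior_subset) ?_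
  intro s hs
  have hs' := interior_subset hs
  have := mul_nonneg (hr s (hI hs')).le (hab s hs')
  linarith

/-- **A strictly convex curve parametrized by its normal stays in an angular sector
determined by its initial tangent** (Proposition `convencadr` of the paper): if `c`
is parametrized by its normal on `(θ − ε, θ + β]` with `0 < β ≤ π/2`, then every
point `c(t)`, `t ∈ [θ, θ + β]`, lies in the closed angular sector with vertex `c(θ)`
delimited by the half-lines in the directions `(cos θ, sin θ)` and
`(cos(θ+β), sin(θ+β))`. -/
theorem stmt_7 (θ β ε : ℝ) (hβ0 : 0 < β) (hβ : β ≤ π / 2) (hε : 0 < ε)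
    (c : ℝ → ℝ × ℝ) (hc : IsStrictConvexNormalParam (Set.Ioc (θ - ε) (θ + β)) c) :
    ∀ t ∈ Set.Icc θ (θ + β), ∃ lam : ℝ, 0 ≤ lam ∧ ∃ φ ∈ Set.Icc θ (θ + β),
      c t = c θ + lam • ((Real.cos φ, Real.sin φ) : ℝ × ℝ) := by
  intro t ht
  have hI : Icc θ (θ + β) ⊆ Ioc (θ - ε) (θ + β) :=
    fun s hs => ⟨by linarith [hs.1], hs.2⟩
  have hθ : θ ∈ Icc θ (θ + β) := ⟨le_rfl, by linarith⟩
  have hmono := fun a b hab => hc.monotoneOn_functional hI a b hab hθ ht ht.1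
  set x := (c t).1 - (c θ).1 with hx
  set y := (c t).2 - (c θ).2 with hy
  have hleft : 0 ≤ -x * Real.sin θ + y * Real.cos θ := by
    have := hmono (-Real.sin θ) (Real.cos θ) (fun s hs => by
      have := sin_nonneg_of_nonneg_of_le_pi (x := s - θ) (by linarith [hs.1])
        (by linarith [hs.2, pi_pos])
      rw [Real.sin_sub] at this
      linarith)
    simp only at this
    rw [hx, hy]
    linarith
  have hright : -x * Real.sin (θ + β) + y * Real.cos (θ + β) ≤ 0 := by
    have := hmono (Real.sin (θ + β)) (-Real.cos (θ + β)) (fun s hs => by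
      have := sin_nonneg_of_nonneg_of_le_pi (x := θ + β - s) (by linarith [hs.2])
        (by linarith [hs.1, pi_pos])
      rw [Real.sin_sub] at this
      linarith)
    simp only at this
    rw [hx, hy]
    linarith
  obtain ⟨φ, hφ, hzero⟩ : ∃ φ ∈ Icc θ (θ + β), -x * Real.sin φ + y * Real.cos φ = 0 :=
    intermediate_value_Icc' hθ.2
      (f := fun φ => -x * Real.sin φ + y * Real.cos φ) (by fun_prop) ⟨hright, hleft⟩
  refine ⟨x * Real.cos φ + y * Real.sin φ, ?_, φ, hφ, ?_⟩
  · have := hmono (Real.cos φ) (Real.sin φ) (fun s hs => by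
      have := cos_nonneg_of_neg_pi_div_two_le_of_le (x := s - φ)
        (by linarith [hs.1, hφ.2]) (by linarith [hs.2, hφ.1])
      rw [Real.cos_sub] at this
      linarith)
    simp only at this
    rw [hx, hy]
    linarith
  · have hsq := Real.sin_sq_add_cos_sq φ
    ext
    · simp only [Prod.fst_add, Prod.smul_fst, smul_eq_mul]
      linear_combination (-x) * hsq - Real.sin φ * hzero - hx
    · simp only [Prod.snd_add, Prod.smul_snd, smul_eq_mul]
      linear_combination (-y) * hsq + Real.cos φ * hzero - hy
end

section
/- A bounded strictly convex curve parametrized by its normal has a limit at the open end of its parameter interval: Let β ∈ ℝ and ε > 0, and let c : [β − ε, β) → ℝ² be a strictly convex curve parametrized by its normal whose image is contained in a compact subset of ℝ². Then c(t) converges to a limit in ℝ² as t tends to β from below. -/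
open Real Filter Set

/-- The component of a bounded strictly convex curve in a direction making an acute angle with
all late tangents is eventually monotone, hence converges. -/
theorem IsStrictConvexNormalParam.exists_tendsto_component {β ε : ℝ} (hε : 0 < ε)
    {c : ℝ → ℝ × ℝ} (hc : IsStrictConvexNormalParam (Set.Ico (β - ε) β) c)
    {K : Set (ℝ × ℝ)} (hK : IsCompact K) (him : ∀ t ∈ Set.Ico (β - ε) β, c t ∈ K)
    {θ : ℝ} (hθ : β - 1 ≤ θ) (hθ' : θ ≤ β) :
    ∃ l : ℝ, Tendsto (fun t => Real.cos θ * (c t).1 + Real.sin θ * (c t).2)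
      (nhdsWithin β (Set.Iio β)) (nhds l) := by
  obtain ⟨r, -, hr, hd⟩ := hc
  have hlt : β - min ε (1 / 2) < β := by
    have := lt_min hε (by norm_num : (0 : ℝ) < 1 / 2)
    linarith
  have hsub : Set.Ioo (β - min ε (1 / 2)) β ⊆ Set.Ico (β - ε) β := fun t ht =>
    ⟨by linarith [ht.1, min_le_left ε (1 / 2)], ht.2⟩
  have hderiv : ∀ t ∈ Set.Ioo (β - min ε (1 / 2)) β,
      HasDerivWithinAt (fun t => Real.cos θ * (c t).1 + Real.sin θ * (c t).2)
        (r t * Real.cos (t - θ)) (Set.Ioo (β - min ε (1 / 2)) β) t := by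
    intro t ht
    have h := (hd t (hsub ht)).mono hsub
    have h1 : HasDerivWithinAt (fun t => (c t).1) (r t * Real.cos t)
        (Set.Ioo (β - min ε (1 / 2)) β) t := by
      simpa using h.hasFDerivWithinAt.fst.hasDerivWithinAt
    have h2 : HasDerivWithinAt (fun t => (c t).2) (r t * Real.sin t)
        (Set.Ioo (β - min ε (1 / 2)) β) t := by
      simpa using h.hasFDerivWithinAt.snd.hasDerivWithinAt
    refine ((h1.const_mul (Real.cos θ)).add (h2.const_mul (Real.sin θ))).congr_deriv ?_
    rw [Real.cos_sub]
    ring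
  have hmono : MonotoneOn (fun t => Real.cos θ * (c t).1 + Real.sin θ * (c t).2)
      (Set.Ioo (β - min ε (1 / 2)) β) := by
    refine monotoneOn_of_hasDerivWithinAt_nonneg (f' := fun t => r t * Real.cos (t - θ))
      (convex_Ioo _ _) (fun t ht => (hderiv t ht).continuousWithinAt) ?_ ?_
    · rw [interior_Ioo]
      exact hderiv
    · rw [interior_Ioo]
      intro t ht
      refine mul_nonneg (hr t (hsub ht)).le (Real.cos_nonneg_of_mem_Icc ⟨?_, ?_⟩) <;>
        linarith [ht.1, ht.2, min_le_right ε (1 / 2), Real.pi_gt_three]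
  have hbdd : BddAbove ((fun t => Real.cos θ * (c t).1 + Real.sin θ * (c t).2) ''
      Set.Ioo (β - min ε (1 / 2)) β) := by
    have hcont : Continuous fun p : ℝ × ℝ => Real.cos θ * p.1 + Real.sin θ * p.2 := by fun_prop
    refine (hK.image hcont).bddAbove.mono ?_
    rintro _ ⟨t, ht, rfl⟩
    exact ⟨c t, him t (hsub ht), rfl⟩
  exact ⟨_, hmono.tendsto_nhdsWithin_Ioo_left (Set.nonempty_Ioo.2 hlt) hbdd⟩

/-- **A bounded strictly convex curve parametrized by its normal has a limit at the
open end of its parameter interval** (Lemma `convlim` of the paper): if `c` is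
parametrized by its normal on `[β − ε, β)` with image contained in a compact subset
of `ℝ²`, then `c(t)` converges as `t → β⁻`. -/
theorem stmt_8 (β ε : ℝ) (hε : 0 < ε) (c : ℝ → ℝ × ℝ)
    (hc : IsStrictConvexNormalParam (Set.Ico (β - ε) β) c)
    (K : Set (ℝ × ℝ)) (hK : IsCompact K)
    (him : ∀ t ∈ Set.Ico (β - ε) β, c t ∈ K) :
    ∃ L : ℝ × ℝ, Tendsto c (nhdsWithin β (Set.Ico (β - ε) β)) (nhds L) := by
  obtain ⟨l, hl⟩ := hc.exists_tendsto_component hε hK him (θ := β) (by linarith) le_rfl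
  obtain ⟨m, hm⟩ := hc.exists_tendsto_component hε hK him (θ := β - 1) le_rfl (by linarith)
  rw [nhdsWithin_Ico_eq_nhdsLT (by linarith)]
  have hdet : Real.sin β * Real.cos (β - 1) - Real.cos β * Real.sin (β - 1) ≠ 0 := by
    rw [← Real.sin_sub, sub_sub_cancel]
    exact (Real.sin_pos_of_pos_of_lt_pi one_pos (by linarith [Real.pi_gt_three])).ne'
  have h1 := ((hm.const_mul (Real.sin β)).sub (hl.const_mul (Real.sin (β - 1)))).div_const
    (Real.sin β * Real.cos (β - 1) - Real.cos β * Real.sin (β - 1))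
  have h2 := ((hl.const_mul (Real.cos (β - 1))).sub (hm.const_mul (Real.cos β))).div_const
    (Real.sin β * Real.cos (β - 1) - Real.cos β * Real.sin (β - 1))
  refine ⟨_, (h1.prodMk_nhds h2).congr fun t => Prod.ext ?_ ?_⟩
  · rw [div_eq_iff hdet]
    ring
  · rw [div_eq_iff hdet]
    ring
end

section
/- Limit sets of sequences of strictly convex curves parametrized by their normal that converge away from one parameter value: Let θ ∈ ℝ and 0 < ε < π/4. For each n let cₙ : (θ − ε, θ + ε) → ℝ² be a strictly convex curve parametrized by its normal, and let c̃, defined on (θ − ε, θ) ∪ (θ, θ + ε), be a strictly convex curve parametrized by its normal on each of these two subintervals. Assume that cₙ → c̃ and cₙ' → c̃' uniformly on every compact subset of (θ − ε, θ) ∪ (θ, θ + ε). Then: (a) the one-sided limits p₁ = lim_{t→θ⁻} c̃(t) and p₂ = lim_{t→θ⁺} c̃(t) exist in ℝ²; (b) p₂ − p₁ = λ·(cos θ, sin θ) for some λ ≥ 0 (so the segment [p₁, p₂] has unit normal (sin θ, −cos θ)); (c) every point of the segment [p₁, p₂] is the limit of a sequence (cₙ(tₙ)) with tₙ ∈ (θ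 − ε, θ + ε); (d) for every 0 < ε' < ε, if (n_k) is a strictly increasing sequence of indices, t_{n_k} ∈ [θ − ε', θ + ε'] for all k, and c_{n_k}(t_{n_k}) converges to some x ∈ ℝ², then x belongs to c̃([θ − ε', θ)) ∪ c̃((θ, θ + ε']) ∪ [p₁, p₂]. -/
open Real Filter Set

/-- The component of `p` in the direction `(cos φ, sin φ)`. -/
noncomputable def dirComponent (φ : ℝ) (p : ℝ × ℝ) : ℝ :=
  Real.cos φ * p.1 + Real.sin φ * p.2

lemma continuous_dirComponent (φ : ℝ) : Continuous (dirComponent φ) := by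
  unfold dirComponent
  fun_prop

lemma continuous_dirComponent_left (p : ℝ × ℝ) : Continuous fun φ => dirComponent φ p := by
  unfold dirComponent
  fun_prop

/-- Reconstruction of a point from its components in two orthogonal directions. -/
lemma dirComponent_smul_add_dirComponent_smul (φ : ℝ) (p : ℝ × ℝ) :
    dirComponent φ p • ((Real.cos φ, Real.sin φ) : ℝ × ℝ) +
      dirComponent (φ + π / 2) p • ((-Real.sin φ, Real.cos φ) : ℝ × ℝ) = p := by
  have h := Real.sin_sq_add_cos_sq φ
  ext
  · simp only [dirComponent, Real.cos_add_pi_div_two, Real.sin_add_pi_div_two, Prod.fst_add,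
      Prod.smul_fst, smul_eq_mul]
    linear_combination p.1 * h
  · simp only [dirComponent, Real.cos_add_pi_div_two, Real.sin_add_pi_div_two, Prod.snd_add,
      Prod.smul_snd, smul_eq_mul]
    linear_combination p.2 * h

/-- Components of a curve parametrized by its normal are increasing where the tangent makes an
acute angle with the chosen direction. -/
lemma IsStrictConvexNormalParam.dirComponent_lt {a b : ℝ} {c : ℝ → ℝ × ℝ}
    (hc : IsStrictConvexNormalParam (Ioo a b) c) {φ s t : ℝ} (has : a < s) (hst : s < t)
    (htb : t < b) (hs : φ - π / 2 < s) (ht : t < φ + π / 2) :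
    dirComponent φ (c s) < dirComponent φ (c t) := by
  obtain ⟨r, -, hr, hd⟩ := hc
  have hder : ∀ u ∈ Icc s t,
      HasDerivAt (fun v => dirComponent φ (c v)) (r u * Real.cos (u - φ)) u := by
    intro u hu
    have hu' : u ∈ Ioo a b := ⟨has.trans_le hu.1, hu.2.trans_lt htb⟩
    have h := (hd u hu').hasDerivAt (isOpen_Ioo.mem_nhds hu')
    have h1 : HasDerivAt (fun v => (c v).1) (r u * Real.cos u) u := by
      simpa [Function.comp_def] using hasFDerivAt_fst.comp_hasDerivAt u h
    have h2 : HasDerivAt (fun v => (c v).2) (r u * Real.sin u) u := by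
      simpa [Function.comp_def] using hasFDerivAt_snd.comp_hasDerivAt u h
    refine ((h1.const_mul (Real.cos φ)).add (h2.const_mul (Real.sin φ))).congr_deriv ?_
    rw [Real.cos_sub]
    ring
  have hmono : StrictMonoOn (fun v => dirComponent φ (c v)) (Icc s t) := by
    refine strictMonoOn_of_deriv_pos (convex_Icc s t)
      (fun u hu => (hder u hu).continuousAt.continuousWithinAt) fun u hu => ?_
    rw [interior_Icc] at hu
    rw [(hder u (Ioo_subset_Icc_self hu)).deriv]
    exact mul_pos (hr u ⟨has.trans hu.1, hu.2.trans htb⟩)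
      (Real.cos_pos_of_mem_Ioo ⟨by linarith [hu.1], by linarith [hu.2]⟩)
  exact hmono (left_mem_Icc.2 hst.le) (right_mem_Icc.2 hst.le) hst

lemma IsStrictConvexNormalParam.dirComponent_le {a b : ℝ} {c : ℝ → ℝ × ℝ}
    (hc : IsStrictConvexNormalParam (Ioo a b) c) {φ s t : ℝ} (has : a < s) (hst : s ≤ t)
    (htb : t < b) (hs : φ - π / 2 < s) (ht : t < φ + π / 2) :
    dirComponent φ (c s) ≤ dirComponent φ (c t) := by
  rcases hst.eq_or_lt with rfl | h
  · rfl
  · exact (hc.dirComponent_lt has h htb hs ht).le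

lemma IsStrictConvexNormalParam.continuousOn {I : Set ℝ} {c : ℝ → ℝ × ℝ}
    (hc : IsStrictConvexNormalParam I c) : ContinuousOn c I := by
  obtain ⟨r, -, -, hd⟩ := hc
  exact fun t ht => (hd t ht).continuousWithinAt

/-- Two points whose components are ordered in all directions at an acute angle with
`(cos θ, sin θ)` differ by a nonnegative multiple of that vector. -/
lemma exists_nonneg_smul_of_dirComponent_le {θ : ℝ} {p q : ℝ × ℝ}
    (h : ∀ φ ∈ Ioo (θ - π / 2) (θ + π / 2), dirComponent φ p ≤ dirComponent φ q) :
    ∃ lam : ℝ, 0 ≤ lam ∧ q - p = lam • ((Real.cos θ, Real.sin θ) : ℝ × ℝ) := by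
  have hclosed : ∀ φ ∈ Icc (θ - π / 2) (θ + π / 2), dirComponent φ p ≤ dirComponent φ q := by
    intro φ hφ
    rw [← closure_Ioo (by linarith [Real.pi_pos] : θ - π / 2 ≠ θ + π / 2)] at hφ
    exact le_on_closure h (continuous_dirComponent_left p).continuousOn
      (continuous_dirComponent_left q).continuousOn hφ
  have h1 := hclosed (θ - π / 2) ⟨le_rfl, by linarith [Real.pi_pos]⟩
  have h2 := hclosed (θ + π / 2) ⟨by linarith [Real.pi_pos], le_rfl⟩
  have h0 := hclosed θ ⟨by linarith [Real.pi_pos], by linarith [Real.pi_pos]⟩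
  have heq : dirComponent (θ + π / 2) p = dirComponent (θ + π / 2) q := by
    refine le_antisymm h2 ?_
    simp only [dirComponent, Real.cos_sub_pi_div_two, Real.sin_sub_pi_div_two,
      Real.cos_add_pi_div_two, Real.sin_add_pi_div_two] at h1 ⊢
    linarith
  refine ⟨dirComponent θ q - dirComponent θ p, sub_nonneg.2 h0, ?_⟩
  conv_lhs => rw [← dirComponent_smul_add_dirComponent_smul θ q,
    ← dirComponent_smul_add_dirComponent_smul θ p, heq]
  rw [sub_smul]
  abel

/-- A sequence of points bounded in two orthogonal directions has a convergent subsequence. -/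
lemma exists_tendsto_subseq_of_dirComponent_mem_Icc {φ a b a' b' : ℝ} {y : ℕ → ℝ × ℝ}
    (h : ∀ᶠ n in atTop, dirComponent φ (y n) ∈ Icc a b)
    (h' : ∀ᶠ n in atTop, dirComponent (φ + π / 2) (y n) ∈ Icc a' b') :
    ∃ z, ∃ ms : ℕ → ℕ, StrictMono ms ∧ Tendsto (y ∘ ms) atTop (nhds z) := by
  have hK : IsCompact ((fun q : ℝ × ℝ => q.1 • ((Real.cos φ, Real.sin φ) : ℝ × ℝ) +
      q.2 • ((-Real.sin φ, Real.cos φ) : ℝ × ℝ)) '' (Icc a b ×ˢ Icc a' b')) :=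
    (isCompact_Icc.prod isCompact_Icc).image (by fun_prop)
  obtain ⟨z, -, ms, hms, hz⟩ := hK.isSeqCompact.subseq_of_frequently_in (x := y)
    ((h.and h').mono fun n hn => ⟨(_, _), ⟨hn.1, hn.2⟩,
      dirComponent_smul_add_dirComponent_smul φ (y n)⟩).frequently
  exact ⟨z, ms, hms, hz⟩

lemma tendsto_of_tendsto_dirComponent {α : Type*} {l : Filter α} {y : α → ℝ × ℝ} {φ u v : ℝ}
    (hu : Tendsto (fun a => dirComponent φ (y a)) l (nhds u))
    (hv : Tendsto (fun a => dirComponent (φ + π / 2) (y a)) l (nhds v)) :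
    Tendsto y l (nhds (u • ((Real.cos φ, Real.sin φ) : ℝ × ℝ) +
      v • ((-Real.sin φ, Real.cos φ) : ℝ × ℝ))) :=
  ((hu.smul_const _).add (hv.smul_const _)).congr fun a =>
    dirComponent_smul_add_dirComponent_smul φ (y a)

/-- A limit of points `cₙ(tₙ)` with `tₙ → θ` lies between the one-sided limits at `θ` of the
pointwise limit curve, in the direction `(cos θ, sin θ)`. -/
lemma exists_nonneg_smul_of_tendsto {θ ε : ℝ} (hε : 0 < ε)
    {c : ℕ → ℝ → ℝ × ℝ} {ctilde : ℝ → ℝ × ℝ} {p₁ p₂ x : ℝ × ℝ} {nk : ℕ → ℕ} {t : ℕ → ℝ}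
    (hc : ∀ n, IsStrictConvexNormalParam (Ioo (θ - ε) (θ + ε)) (c n))
    (hpt : ∀ s ∈ Ioo (θ - ε) θ ∪ Ioo θ (θ + ε),
      Tendsto (fun n => c n s) atTop (nhds (ctilde s)))
    (hp₁ : Tendsto ctilde (nhdsWithin θ (Iio θ)) (nhds p₁))
    (hp₂ : Tendsto ctilde (nhdsWithin θ (Ioi θ)) (nhds p₂))
    (hnk : Tendsto nk atTop atTop) (ht : Tendsto t atTop (nhds θ))
    (hx : Tendsto (fun k => c (nk k) (t k)) atTop (nhds x)) :
    (∃ a : ℝ, 0 ≤ a ∧ x - p₁ = a • ((Real.cos θ, Real.sin θ) : ℝ × ℝ)) ∧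
      ∃ b : ℝ, 0 ≤ b ∧ p₂ - x = b • ((Real.cos θ, Real.sin θ) : ℝ × ℝ) := by
  have hlim : ∀ φ, Tendsto (fun k => dirComponent φ (c (nk k) (t k))) atTop
      (nhds (dirComponent φ x)) := fun φ => ((continuous_dirComponent φ).tendsto x).comp hx
  have hlim' : ∀ φ, ∀ s ∈ Ioo (θ - ε) θ ∪ Ioo θ (θ + ε),
      Tendsto (fun k => dirComponent φ (c (nk k) s)) atTop
        (nhds (dirComponent φ (ctilde s))) := fun φ s hs =>
    ((continuous_dirComponent φ).tendsto _).comp ((hpt s hs).comp hnk)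
  constructor
  · refine exists_nonneg_smul_of_dirComponent_le fun φ hφ => ?_
    refine le_of_tendsto (((continuous_dirComponent φ).tendsto p₁).comp hp₁) ?_
    have hmax : max (θ - ε) (φ - π / 2) < θ := max_lt (by linarith) (by linarith [hφ.2])
    filter_upwards [Ioo_mem_nhdsLT hmax] with s hs
    have hs' := max_lt_iff.1 hs.1
    refine le_of_tendsto_of_tendsto (hlim' φ s (Or.inl ⟨hs'.1, hs.2⟩)) (hlim φ) ?_
    filter_upwards [ht.eventually_const_lt hs.2,
      ht.eventually_lt_const (by linarith : θ < θ + ε),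
      ht.eventually_lt_const (by linarith [hφ.1] : θ < φ + π / 2)] with k h1 h2 h3
    exact (hc _).dirComponent_le hs'.1 h1.le h2 hs'.2 h3
  · refine exists_nonneg_smul_of_dirComponent_le fun φ hφ => ?_
    refine ge_of_tendsto (((continuous_dirComponent φ).tendsto p₂).comp hp₂) ?_
    have hmin : θ < min (θ + ε) (φ + π / 2) := lt_min (by linarith) (by linarith [hφ.1])
    filter_upwards [Ioo_mem_nhdsGT hmin] with s hs
    have hs' := lt_min_iff.1 hs.2
    refine le_of_tendsto_of_tendsto (hlim φ) (hlim' φ s (Or.inr ⟨hs.1, hs'.1⟩)) ?_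
    filter_upwards [ht.eventually_lt_const hs.1,
      ht.eventually_const_lt (by linarith : θ - ε < θ),
      ht.eventually_const_lt (by linarith [hφ.2] : φ - π / 2 < θ)] with k h1 h2 h3
    exact (hc _).dirComponent_le h2 h1.le hs'.1 h3 hs'.2

/-- **Limit sets of sequences of strictly convex curves parametrized by their normal
that converge away from one parameter value** (Proposition `convcomp` of the paper):
if `cₙ → c̃` in `C¹` uniformly on compact subsets of `(θ−ε,θ) ∪ (θ,θ+ε)`, then the
one-sided limits `p₁, p₂` of `c̃` at `θ` exist, `p₂ − p₁` is a nonnegative multiple of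
`(cos θ, sin θ)`, every point of the segment `[p₁,p₂]` is a limit of points `cₙ(tₙ)`,
and every limit of a subsequence `c_{n_k}(t_{n_k})` with parameters in
`[θ−ε', θ+ε']` lies in `c̃([θ−ε',θ)) ∪ c̃((θ,θ+ε']) ∪ [p₁,p₂]`. -/
theorem stmt_9 (θ ε : ℝ) (hε0 : 0 < ε) (hε : ε < π / 4)
    (c : ℕ → ℝ → ℝ × ℝ) (ctilde : ℝ → ℝ × ℝ)
    (hc : ∀ n, IsStrictConvexNormalParam (Set.Ioo (θ - ε) (θ + ε)) (c n))
    (hctm : IsStrictConvexNormalParam (Set.Ioo (θ - ε) θ) ctilde)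
    (hctp : IsStrictConvexNormalParam (Set.Ioo θ (θ + ε)) ctilde)
    (hconv : ∀ K ⊆ Set.Ioo (θ - ε) θ ∪ Set.Ioo θ (θ + ε), IsCompact K →
      TendstoUniformlyOn (fun n => c n) ctilde atTop K ∧
      TendstoUniformlyOn (fun n => deriv (c n)) (deriv ctilde) atTop K) :
    ∃ p₁ p₂ : ℝ × ℝ,
      Tendsto ctilde (nhdsWithin θ (Set.Iio θ)) (nhds p₁) ∧
      Tendsto ctilde (nhdsWithin θ (Set.Ioi θ)) (nhds p₂) ∧
      (∃ lam : ℝ, 0 ≤ lam ∧ p₂ - p₁ = lam • ((Real.cos θ, Real.sin θ) : ℝ × ℝ)) ∧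
      (∀ x ∈ segment ℝ p₁ p₂, ∃ t : ℕ → ℝ,
        (∀ n, t n ∈ Set.Ioo (θ - ε) (θ + ε)) ∧
        Tendsto (fun n => c n (t n)) atTop (nhds x)) ∧
      (∀ ε' : ℝ, 0 < ε' → ε' < ε → ∀ nk : ℕ → ℕ, StrictMono nk →
        ∀ t : ℕ → ℝ, (∀ k, t k ∈ Set.Icc (θ - ε') (θ + ε')) →
        ∀ x : ℝ × ℝ, Tendsto (fun k => c (nk k) (t k)) atTop (nhds x) →
          x ∈ ctilde '' Set.Ico (θ - ε') θ ∪ ctilde '' Set.Ioc θ (θ + ε') ∪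
            segment ℝ p₁ p₂) := by
  have hπ := Real.pi_pos
  have hpt : ∀ s ∈ Ioo (θ - ε) θ ∪ Ioo θ (θ + ε),
      Tendsto (fun n => c n s) atTop (nhds (ctilde s)) := fun s hs =>
    ((hconv {s} (singleton_subset_iff.2 hs) isCompact_singleton).1).tendsto_at rfl
  have hF : ∀ φ, ∀ s ∈ Ioo (θ - ε) θ ∪ Ioo θ (θ + ε),
      Tendsto (fun n => dirComponent φ (c n s)) atTop (nhds (dirComponent φ (ctilde s))) :=
    fun φ s hs => ((continuous_dirComponent φ).tendsto _).comp (hpt s hs)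
  have hcross : ∀ φ, ∀ s ∈ Ioo (θ - ε) θ, ∀ t ∈ Ioo θ (θ + ε), φ - π / 2 < s → t < φ + π / 2 →
      dirComponent φ (ctilde s) ≤ dirComponent φ (ctilde t) := by
    intro φ s hs t ht h1 h2
    exact le_of_tendsto_of_tendsto' (hF φ s (Or.inl hs)) (hF φ t (Or.inr ht)) fun n =>
      (hc n).dirComponent_le hs.1 (hs.2.trans ht.1).le ht.2 h1 h2
  have hleft : ∀ φ, φ - π / 2 ≤ θ - ε → θ + ε ≤ φ + π / 2 →
      ∃ u, Tendsto (fun s => dirComponent φ (ctilde s)) (nhdsWithin θ (Iio θ)) (nhds u) := by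
    intro φ h1 h2
    refine ⟨_, MonotoneOn.tendsto_nhdsWithin_Ioo_left
      (nonempty_Ioo.2 (by linarith : θ - ε < θ)) ?_ ?_⟩
    · intro s hs t ht hst
      exact hctm.dirComponent_le hs.1 hst ht.2 (by linarith [hs.1]) (by linarith [ht.2])
    · refine ⟨dirComponent φ (ctilde (θ + ε / 2)), ?_⟩
      rintro _ ⟨s, hs, rfl⟩
      exact hcross φ s hs _ ⟨by linarith, by linarith⟩ (by linarith [hs.1]) (by linarith)
  have hright : ∀ φ, φ - π / 2 ≤ θ - ε → θ + ε ≤ φ + π / 2 →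
      ∃ u, Tendsto (fun s => dirComponent φ (ctilde s)) (nhdsWithin θ (Ioi θ)) (nhds u) := by
    intro φ h1 h2
    refine ⟨_, MonotoneOn.tendsto_nhdsWithin_Ioo_right
      (nonempty_Ioo.2 (by linarith : θ < θ + ε)) ?_ ?_⟩
    · intro s hs t ht hst
      exact hctp.dirComponent_le hs.1 hst ht.2 (by linarith [hs.1]) (by linarith [ht.2])
    · refine ⟨dirComponent φ (ctilde (θ - ε / 2)), ?_⟩
      rintro _ ⟨s, hs, rfl⟩
      exact hcross φ _ ⟨by linarith, by linarith⟩ s hs (by linarith) (by linarith [hs.2])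
  obtain ⟨p₁, hp₁⟩ : ∃ p₁, Tendsto ctilde (nhdsWithin θ (Iio θ)) (nhds p₁) := by
    obtain ⟨u, hu⟩ := hleft (θ - π / 4) (by linarith) (by linarith)
    obtain ⟨v, hv⟩ := hleft (θ - π / 4 + π / 2) (by linarith) (by linarith)
    exact ⟨_, tendsto_of_tendsto_dirComponent hu hv⟩
  obtain ⟨p₂, hp₂⟩ : ∃ p₂, Tendsto ctilde (nhdsWithin θ (Ioi θ)) (nhds p₂) := by
    obtain ⟨u, hu⟩ := hright (θ - π / 4) (by linarith) (by linarith)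
    obtain ⟨v, hv⟩ := hright (θ - π / 4 + π / 2) (by linarith) (by linarith)
    exact ⟨_, tendsto_of_tendsto_dirComponent hu hv⟩
  have hp₁F : ∀ φ, Tendsto (fun s => dirComponent φ (ctilde s)) (nhdsWithin θ (Iio θ))
      (nhds (dirComponent φ p₁)) := fun φ => ((continuous_dirComponent φ).tendsto p₁).comp hp₁
  have hp₂F : ∀ φ, Tendsto (fun s => dirComponent φ (ctilde s)) (nhdsWithin θ (Ioi θ))
      (nhds (dirComponent φ p₂)) := fun φ => ((continuous_dirComponent φ).tendsto p₂).comp hp₂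
  have hlam : ∃ lam : ℝ, 0 ≤ lam ∧ p₂ - p₁ = lam • ((Real.cos θ, Real.sin θ) : ℝ × ℝ) := by
    refine exists_nonneg_smul_of_dirComponent_le fun φ hφ => ?_
    have hmax : max (θ - ε) (φ - π / 2) < θ := max_lt (by linarith) (by linarith [hφ.2])
    have hmin : θ < min (θ + ε) (φ + π / 2) := lt_min (by linarith) (by linarith [hφ.1])
    refine le_of_tendsto (hp₁F φ) ?_
    filter_upwards [Ioo_mem_nhdsLT hmax] with s hs
    refine ge_of_tendsto (hp₂F φ) ?_
    filter_upwards [Ioo_mem_nhdsGT hmin] with t ht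
    have hs' := max_lt_iff.1 hs.1
    have ht' := lt_min_iff.1 ht.2
    exact hcross φ s ⟨hs'.1, hs.2⟩ t ⟨ht.1, ht'.1⟩ hs'.2 ht'.2
  refine ⟨p₁, p₂, hp₁, hp₂, hlam, ?_, ?_⟩
  · intro x hx
    obtain ⟨lam, hlam0, hlam⟩ := hlam
    obtain ⟨μ, ⟨hμ0, hμ1⟩, rfl⟩ := (segment_eq_image' ℝ p₁ p₂ ▸ hx :
      x ∈ (fun μ : ℝ => p₁ + μ • (p₂ - p₁)) '' Icc (0 : ℝ) 1)
    set x := p₁ + μ • (p₂ - p₁) with hxdef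
    have hdir : ∀ (y : ℝ × ℝ) (a : ℝ), y - p₁ = a • ((Real.cos θ, Real.sin θ) : ℝ × ℝ) →
        dirComponent θ y = dirComponent θ p₁ + a := by
      intro y a h
      have h1 : y.1 - p₁.1 = a * Real.cos θ := congrArg Prod.fst h
      have h2 : y.2 - p₁.2 = a * Real.sin θ := congrArg Prod.snd h
      unfold dirComponent
      linear_combination Real.cos θ * h1 + Real.sin θ * h2 + a * Real.sin_sq_add_cos_sq θ
    have hxp : x - p₁ = (μ * lam) • ((Real.cos θ, Real.sin θ) : ℝ × ℝ) := by
      rw [hxdef, add_sub_cancel_left, hlam, smul_smul]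
    have hx1 : dirComponent θ p₁ ≤ dirComponent θ x := by
      rw [hdir x _ hxp]
      nlinarith
    have hx2 : dirComponent θ x ≤ dirComponent θ p₂ := by
      rw [hdir x _ hxp, hdir p₂ _ hlam]
      nlinarith
    have hltL : ∀ s ∈ Ioo (θ - ε) θ, dirComponent θ (ctilde s) < dirComponent θ x := by
      intro s hs
      obtain ⟨u, hsu, huθ⟩ := exists_between hs.2
      refine (hctm.dirComponent_lt hs.1 hsu huθ (by linarith [hs.1]) (by linarith)).trans_le
        (le_trans (ge_of_tendsto (hp₁F θ) ?_) hx1)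
      filter_upwards [Ioo_mem_nhdsLT huθ] with v hv
      exact hctm.dirComponent_le (hs.1.trans hsu) hv.1.le hv.2 (by linarith [hs.1])
        (by linarith [hv.2])
    have hltR : ∀ s ∈ Ioo θ (θ + ε), dirComponent θ x < dirComponent θ (ctilde s) := by
      intro s hs
      obtain ⟨u, hθu, hus⟩ := exists_between hs.1
      refine (hx2.trans (le_of_tendsto (hp₂F θ) ?_)).trans_lt
        (hctp.dirComponent_lt hθu hus hs.2 (by linarith) (by linarith [hs.2]))
      filter_upwards [Ioo_mem_nhdsGT hθu] with v hv
      exact hctp.dirComponent_le hv.1 hv.2.le (hus.trans hs.2) (by linarith [hv.1])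
        (by linarith [hs.2])
    have hmL : θ - ε / 2 ∈ Ioo (θ - ε) θ := ⟨by linarith, by linarith⟩
    have hmR : θ + ε / 2 ∈ Ioo θ (θ + ε) := ⟨by linarith, by linarith⟩
    have hivt : ∀ᶠ n in atTop, ∃ t ∈ Ioo (θ - ε) (θ + ε),
        dirComponent θ (c n t) = dirComponent θ x := by
      filter_upwards [(hF θ _ (Or.inl hmL)).eventually_lt_const (hltL _ hmL),
        (hF θ _ (Or.inr hmR)).eventually_const_lt (hltR _ hmR)] with n h1 h2
      have hsub : Icc (θ - ε / 2) (θ + ε / 2) ⊆ Ioo (θ - ε) (θ + ε) :=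
        Icc_subset_Ioo (by linarith) (by linarith)
      obtain ⟨t, ht, hteq⟩ := intermediate_value_Icc (by linarith : θ - ε / 2 ≤ θ + ε / 2)
        ((continuous_dirComponent θ).comp_continuousOn ((hc n).continuousOn.mono hsub))
        ⟨h1.le, h2.le⟩
      exact ⟨t, hsub ht, hteq⟩
    have hsel : ∀ n, ∃ t ∈ Ioo (θ - ε) (θ + ε),
        (∃ t ∈ Ioo (θ - ε) (θ + ε), dirComponent θ (c n t) = dirComponent θ x) →
          dirComponent θ (c n t) = dirComponent θ x := by
      intro n
      by_cases h : ∃ t ∈ Ioo (θ - ε) (θ + ε), dirComponent θ (c n t) = dirComponent θ x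
      · obtain ⟨t, ht, hteq⟩ := h
        exact ⟨t, ht, fun _ => hteq⟩
      · exact ⟨θ, ⟨by linarith, by linarith⟩, fun h' => absurd h' h⟩
    choose t htmem hteq using hsel
    have hteq' : ∀ᶠ n in atTop, dirComponent θ (c n (t n)) = dirComponent θ x :=
      hivt.mono fun n hn => hteq n hn
    have hgt : ∀ s ∈ Ioo (θ - ε) θ, ∀ᶠ n in atTop, s < t n := by
      intro s hs
      filter_upwards [hteq', (hF θ s (Or.inl hs)).eventually_lt_const (hltL s hs)] with n h1 h2
      by_contra! hle
      have := (hc n).dirComponent_le (φ := θ) (htmem n).1 hle (by linarith [hs.2])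
        (by linarith [(htmem n).1]) (by linarith [hs.2])
      linarith
    have hlt : ∀ s ∈ Ioo θ (θ + ε), ∀ᶠ n in atTop, t n < s := by
      intro s hs
      filter_upwards [hteq', (hF θ s (Or.inr hs)).eventually_const_lt (hltR s hs)] with n h1 h2
      by_contra! hle
      have := (hc n).dirComponent_le (φ := θ) (by linarith [hs.1]) hle (htmem n).2
        (by linarith [hs.1]) (by linarith [(htmem n).2])
      linarith
    have htθ : Tendsto t atTop (nhds θ) := by
      refine tendsto_order.2 ⟨fun a ha => ?_, fun a ha => ?_⟩
      · obtain ⟨s, hs, hsθ⟩ := exists_between (max_lt ha (by linarith : θ - ε < θ))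
        have hs' := max_lt_iff.1 hs
        exact (hgt s ⟨hs'.2, hsθ⟩).mono fun n hn => hs'.1.trans hn
      · obtain ⟨s, hθs, hs⟩ := exists_between (lt_min ha (by linarith : θ < θ + ε))
        have hs' := lt_min_iff.1 hs
        exact (hlt s ⟨hθs, hs'.2⟩).mono fun n hn => hn.trans hs'.1
    refine ⟨t, htmem, tendsto_of_subseq_tendsto fun ns hns => ?_⟩
    have hbd : ∀ φ, φ - π / 2 ≤ θ - ε → θ + ε ≤ φ + π / 2 → ∀ᶠ k in atTop,
        dirComponent φ (c (ns k) (t (ns k))) ∈ Icc (dirComponent φ (ctilde (θ - ε / 2)) - 1)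
          (dirComponent φ (ctilde (θ + ε / 2)) + 1) := by
      intro φ h1 h2
      refine hns.eventually (p := fun n => dirComponent φ (c n (t n)) ∈ Icc _ _) ?_
      filter_upwards [hgt _ hmL, hlt _ hmR,
        (hF φ _ (Or.inl hmL)).eventually_const_lt (sub_one_lt _),
        (hF φ _ (Or.inr hmR)).eventually_lt_const (lt_add_one _)] with n h3 h4 h5 h6
      exact ⟨h5.le.trans ((hc n).dirComponent_le hmL.1 h3.le (htmem n).2 (by linarith)
        (by linarith)), ((hc n).dirComponent_le (htmem n).1 h4.le hmR.2 (by linarith)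
        (by linarith)).trans h6.le⟩
    obtain ⟨z, ms, hms, hz⟩ := exists_tendsto_subseq_of_dirComponent_mem_Icc
      (hbd (θ - π / 4) (by linarith) (by linarith))
      (hbd (θ - π / 4 + π / 2) (by linarith) (by linarith))
    have hnm : Tendsto (fun k => ns (ms k)) atTop atTop := hns.comp hms.tendsto_atTop
    obtain ⟨⟨a, -, ha⟩, -⟩ := exists_nonneg_smul_of_tendsto hε0 hc hpt hp₁ hp₂ hnm
      (htθ.comp hnm) hz
    have hzx : dirComponent θ z = dirComponent θ x :=
      tendsto_nhds_unique (((continuous_dirComponent θ).tendsto z).comp hz)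
        (tendsto_const_nhds.congr' ((hnm.eventually hteq').mono fun k hk => hk.symm))
    have haμ : a = μ * lam := by
      rw [hdir z _ ha, hdir x _ hxp] at hzx
      linarith
    have : z = x := by
      rw [haμ, ← hxp] at ha
      exact sub_left_injective ha
    subst this
    exact ⟨ms, hz⟩
  · intro ε' hε'0 hε'ε nk hnk t ht x hx
    obtain ⟨τ, hτ, ms, hms, htτ⟩ := isCompact_Icc.tendsto_subseq ht
    have hnm : Tendsto (fun k => nk (ms k)) atTop atTop :=
      hnk.tendsto_atTop.comp hms.tendsto_atTop
    have hxm : Tendsto (fun k => c (nk (ms k)) (t (ms k))) atTop (nhds x) :=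
      hx.comp hms.tendsto_atTop
    by_cases hτθ : τ = θ
    · subst hτθ
      obtain ⟨⟨a, ha0, ha⟩, b, hb0, hb⟩ := exists_nonneg_smul_of_tendsto hε0 hc hpt hp₁ hp₂ hnm
        htτ hxm
      refine Or.inr (mem_segment_iff_sameRay.2 ?_)
      rw [ha, hb]
      exact (SameRay.sameRay_nonneg_smul_left _ ha0).trans
        (SameRay.sameRay_nonneg_smul_right _ hb0) fun h => by
          have h1 : Real.cos τ = 0 := congrArg Prod.fst h
          have h2 : Real.sin τ = 0 := congrArg Prod.snd h
          have := Real.sin_sq_add_cos_sq τ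
          simp [h1, h2] at this
    · have hlimit : x = ctilde τ := by
        have hmem : τ ∈ Ioo (θ - ε) θ ∪ Ioo θ (θ + ε) := by
          rcases lt_or_gt_of_ne hτθ with h | h
          · exact Or.inl ⟨by linarith [hτ.1], h⟩
          · exact Or.inr ⟨h, by linarith [hτ.2]⟩
        have hopen : IsOpen (Ioo (θ - ε) θ ∪ Ioo θ (θ + ε)) := isOpen_Ioo.union isOpen_Ioo
        obtain ⟨K, hKc, hKτ, hK⟩ :=
          exists_compact_subset hopen hmem
        have hcont : ContinuousAt ctilde τ := by
          rcases hmem with h | h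
          · exact hctm.continuousOn.continuousAt (isOpen_Ioo.mem_nhds h)
          · exact hctp.continuousOn.continuousAt (isOpen_Ioo.mem_nhds h)
        have hunif : TendstoUniformlyOn (fun k => c (nk (ms k))) ctilde atTop K :=
          fun u hu => hnm.eventually ((hconv K hK hKc).1 u hu)
        have hKnhds := mem_interior_iff_mem_nhds.1 hKτ
        exact tendsto_nhds_unique hxm (hunif.tendsto_comp hcont.continuousWithinAt
          (tendsto_nhdsWithin_iff.2 ⟨htτ, htτ.eventually hKnhds⟩))
      refine Or.inl ?_
      rcases lt_or_gt_of_ne hτθ with h | h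
      · exact Or.inl ⟨τ, ⟨hτ.1, h⟩, hlimit.symm⟩
      · exact Or.inr ⟨τ, ⟨h, hτ.2⟩, hlimit.symm⟩
end

section
/- Uniform convergence across the exceptional parameter when the two one-sided limits coincide: Let θ ∈ ℝ and 0 < ε < π/4. For each n let cₙ : (θ − ε, θ + ε) → ℝ² be a strictly convex curve parametrized by its normal, and let c̃, defined on (θ − ε, θ) ∪ (θ, θ + ε), be a strictly convex curve parametrized by its normal on each of these two subintervals. Assume that cₙ → c̃ and cₙ' → c̃' uniformly on every compact subset of (θ − ε, θ) ∪ (θ, θ + ε), and that the one-sided limits p₁ = lim_{t→θ⁻} c̃(t) and p₂ = lim_{t→θ⁺} c̃(t) exist and satisfy p₁ = p₂. Extend c̃ to (θ − ε, θ + ε) by setting c̃(θ) = p₁, so that c̃ is continuous. Then cₙ converges to c̃ uniformly on every compact subset of (θ − ε, θ + ε). -/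
open Real Filter Set

/-- A linear functional that is nonnegative on all tangent directions is monotone along the
curve. -/
lemma IsStrictConvexNormalParam.monotoneOn_linear {x y : ℝ} {c : ℝ → ℝ × ℝ}
    (hc : IsStrictConvexNormalParam (Set.Ioo x y) c) {a b : ℝ}
    (hab : ∀ t ∈ Set.Ioo x y, 0 ≤ a * Real.cos t + b * Real.sin t) :
    MonotoneOn (fun t => a * (c t).1 + b * (c t).2) (Set.Ioo x y) := by
  obtain ⟨r, -, hr, hd⟩ := hc
  have hderiv : ∀ t ∈ Set.Ioo x y, HasDerivAt (fun t => a * (c t).1 + b * (c t).2)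
      (a * (r t * Real.cos t) + b * (r t * Real.sin t)) t := by
    intro t ht
    have h := (hd t ht).hasDerivAt (isOpen_Ioo.mem_nhds ht)
    have h₁ := (ContinuousLinearMap.fst ℝ ℝ ℝ).hasFDerivAt.comp_hasDerivAt t h
    have h₂ := (ContinuousLinearMap.snd ℝ ℝ ℝ).hasFDerivAt.comp_hasDerivAt t h
    exact (h₁.const_mul a).add (h₂.const_mul b)
  refine monotoneOn_of_deriv_nonneg (convex_Ioo x y)
    (fun t ht => (hderiv t ht).continuousAt.continuousWithinAt) ?_ ?_ <;> rw [interior_Ioo]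
  · exact fun t ht => (hderiv t ht).differentiableAt.differentiableWithinAt
  · intro t ht
    rw [(hderiv t ht).deriv]
    have := mul_nonneg (hr t ht).le (hab t ht)
    linarith

/-- If `a * q.1 + b * q.2` is monotone along the curve, its deviation from the value at `p` is
controlled by the endpoints. -/
lemma abs_linear_sub_le_of_monotoneOn {I : Set ℝ} {c : ℝ → ℝ × ℝ} {a b : ℝ}
    (hmono : MonotoneOn (fun t => a * (c t).1 + b * (c t).2) I)
    (ha : |a| ≤ 2) (hb : |b| ≤ 2) (p : ℝ × ℝ) {l t u : ℝ}
    (hl : l ∈ I) (ht : t ∈ I) (hu : u ∈ I) (hlt : l ≤ t) (htu : t ≤ u) :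
    |a * ((c t).1 - p.1) + b * ((c t).2 - p.2)| ≤ 4 * (‖c l - p‖ + ‖c u - p‖) := by
  have key : ∀ s, |a * ((c s).1 - p.1) + b * ((c s).2 - p.2)| ≤ 4 * ‖c s - p‖ := by
    intro s
    have h₁ : |(c s).1 - p.1| ≤ ‖c s - p‖ := norm_fst_le (c s - p)
    have h₂ : |(c s).2 - p.2| ≤ ‖c s - p‖ := norm_snd_le (c s - p)
    calc _ ≤ |a| * |(c s).1 - p.1| + |b| * |(c s).2 - p.2| := by
          rw [← abs_mul, ← abs_mul]; exact abs_add_le _ _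
      _ ≤ 2 * ‖c s - p‖ + 2 * ‖c s - p‖ := by gcongr
      _ = _ := by ring
  have h₁ := hmono hl ht hlt
  have h₂ := hmono ht hu htu
  have h₃ := abs_le.1 (key l)
  have h₄ := abs_le.1 (key u)
  have h₅ := norm_nonneg (c l - p)
  have h₆ := norm_nonneg (c u - p)
  simp only at h₁ h₂
  rw [abs_le]
  constructor <;> linarith [h₃.1, h₄.2]

/-- On a parameter interval of half-width less than `π / 4`, the distance of a strictly convex
curve to a point is controlled by the distances at two enclosing parameters. -/
lemma IsStrictConvexNormalParam.norm_sub_le {θ ε : ℝ} (hε : ε < π / 4) {c : ℝ → ℝ × ℝ}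
    (hc : IsStrictConvexNormalParam (Set.Ioo (θ - ε) (θ + ε)) c) (p : ℝ × ℝ) {l t u : ℝ}
    (hl : l ∈ Set.Ioo (θ - ε) (θ + ε)) (hu : u ∈ Set.Ioo (θ - ε) (θ + ε))
    (hlt : l ≤ t) (htu : t ≤ u) :
    ‖c t - p‖ ≤ 8 * (‖c l - p‖ + ‖c u - p‖) := by
  have ht : t ∈ Set.Ioo (θ - ε) (θ + ε) := ⟨hl.1.trans_le hlt, htu.trans_lt hu.2⟩
  have hsin : ∀ s ∈ Set.Ioo (θ - ε) (θ + ε),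
      |Real.sin (s - θ)| ≤ Real.cos (s - θ) := by
    intro s hs
    have hlt : |s - θ| < π / 4 := abs_lt.2 ⟨by linarith [hs.1], by linarith [hs.2]⟩
    have h₁ := le_abs_self (s - θ)
    have h₂ := neg_abs_le (s - θ)
    have h₃ := abs_nonneg (s - θ)
    rw [abs_le, ← Real.cos_abs, ← Real.sin_pi_div_two_sub, ← Real.sin_neg]
    constructor <;> apply Real.sin_le_sin_of_le_of_le_pi_div_two <;> linarith
  have hC := abs_le.1 (Real.abs_cos_le_one θ)
  have hS := abs_le.1 (Real.abs_sin_le_one θ)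
  have hA := abs_linear_sub_le_of_monotoneOn
    (hc.monotoneOn_linear (a := Real.cos θ - Real.sin θ) (b := Real.sin θ + Real.cos θ)
      (fun s hs => by
        have := (abs_le.1 (hsin s hs)).1
        rw [Real.sin_sub, Real.cos_sub] at this
        linarith))
    (abs_le.2 ⟨by linarith, by linarith⟩) (abs_le.2 ⟨by linarith, by linarith⟩) p hl ht hu hlt htu
  have hB := abs_linear_sub_le_of_monotoneOn
    (hc.monotoneOn_linear (a := Real.cos θ + Real.sin θ) (b := Real.sin θ - Real.cos θ)
      (fun s hs => by
        have := (abs_le.1 (hsin s hs)).2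
        rw [Real.sin_sub, Real.cos_sub] at this
        linarith))
    (abs_le.2 ⟨by linarith, by linarith⟩) (abs_le.2 ⟨by linarith, by linarith⟩) p hl ht hu hlt htu
  set M := ‖c l - p‖ + ‖c u - p‖
  set x := (c t).1 - p.1 with hx
  set y := (c t).2 - p.2 with hy
  have hF : |Real.cos θ * x + Real.sin θ * y| ≤ 4 * M := by
    rw [abs_le] at *
    constructor <;> linarith [hA.1, hA.2, hB.1, hB.2]
  have hG : |Real.cos θ * y - Real.sin θ * x| ≤ 4 * M := by
    rw [abs_le] at *
    constructor <;> linarith [hA.1, hA.2, hB.1, hB.2]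
  have hcomb : ∀ a b F G : ℝ, |a| ≤ 1 → |b| ≤ 1 → |F| ≤ 4 * M → |G| ≤ 4 * M →
      |a * F + b * G| ≤ 8 * M := by
    intro a b F G ha hb hF hG
    calc _ ≤ |a| * |F| + |b| * |G| := by
          rw [← abs_mul, ← abs_mul]; exact abs_add_le _ _
      _ ≤ 1 * (4 * M) + 1 * (4 * M) := by gcongr
      _ = _ := by ring
  have hsq := Real.sin_sq_add_cos_sq θ
  rw [Prod.norm_def]
  refine max_le ?_ ?_
  · have h := hcomb (Real.cos θ) (-Real.sin θ) _ _ (Real.abs_cos_le_one θ)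
      (by rw [abs_neg]; exact Real.abs_sin_le_one θ) hF hG
    have e : Real.cos θ * (Real.cos θ * x + Real.sin θ * y) +
        -Real.sin θ * (Real.cos θ * y - Real.sin θ * x) = x := by
      linear_combination x * hsq
    rwa [e] at h
  · have h := hcomb (Real.sin θ) (Real.cos θ) _ _ (Real.abs_sin_le_one θ)
      (Real.abs_cos_le_one θ) hF hG
    have e : Real.sin θ * (Real.cos θ * x + Real.sin θ * y) +
        Real.cos θ * (Real.cos θ * y - Real.sin θ * x) = y := by
      linear_combination y * hsq
    rwa [e] at h

/-- **Uniform convergence across the exceptional parameter when the two one-sided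
limits coincide** (final part of Proposition `convcomp` of the paper): if moreover
the one-sided limits `p₁ = p₂ = p` of `c̃` at `θ` coincide, then, extending `c̃`
continuously by `c̃(θ) = p`, the sequence `cₙ` converges to the extended `c̃`
uniformly on every compact subset of `(θ − ε, θ + ε)`. -/
theorem stmt_10 (θ ε : ℝ) (hε0 : 0 < ε) (hε : ε < π / 4)
    (c : ℕ → ℝ → ℝ × ℝ) (ctilde : ℝ → ℝ × ℝ) (p : ℝ × ℝ)
    (hc : ∀ n, IsStrictConvexNormalParam (Set.Ioo (θ - ε) (θ + ε)) (c n))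
    (hctm : IsStrictConvexNormalParam (Set.Ioo (θ - ε) θ) ctilde)
    (hctp : IsStrictConvexNormalParam (Set.Ioo θ (θ + ε)) ctilde)
    (hconv : ∀ K ⊆ Set.Ioo (θ - ε) θ ∪ Set.Ioo θ (θ + ε), IsCompact K →
      TendstoUniformlyOn (fun n => c n) ctilde atTop K ∧
      TendstoUniformlyOn (fun n => deriv (c n)) (deriv ctilde) atTop K)
    (hlim₁ : Tendsto ctilde (nhdsWithin θ (Set.Iio θ)) (nhds p))
    (hlim₂ : Tendsto ctilde (nhdsWithin θ (Set.Ioi θ)) (nhds p)) :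
    ∀ K ⊆ Set.Ioo (θ - ε) (θ + ε), IsCompact K →
      TendstoUniformlyOn (fun n => c n) (Function.update ctilde θ p) atTop K := by
  intro K hK hKc
  rw [Metric.tendstoUniformlyOn_iff]
  intro η hη
  obtain ⟨η', hη', hηη'⟩ : ∃ η' > 0, 33 * η' < η := ⟨η / 34, by positivity, by linarith⟩
  obtain ⟨δ₁, hδ₁, h₁⟩ := Metric.tendsto_nhdsWithin_nhds.1 hlim₁ η' hη'
  obtain ⟨δ₂, hδ₂, h₂⟩ := Metric.tendsto_nhdsWithin_nhds.1 hlim₂ η' hη'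
  obtain ⟨δ, hδ, hδlt⟩ := exists_between (lt_min hε0 (lt_min hδ₁ hδ₂))
  obtain ⟨hδε, hδδ₁, hδδ₂⟩ : δ < ε ∧ δ < δ₁ ∧ δ < δ₂ := by
    simpa only [lt_min_iff] using hδlt
  have hnear : ∀ t, t ≠ θ → |t - θ| ≤ δ → ‖ctilde t - p‖ < η' := by
    intro t hne ht
    rw [← dist_eq_norm]
    rcases hne.lt_or_gt with h | h
    · exact h₁ h (by rw [Real.dist_eq]; linarith)
    · exact h₂ h (by rw [Real.dist_eq]; linarith)
  have hnear' : ∀ t, |t - θ| ≤ δ → ‖Function.update ctilde θ p t - p‖ < η' := by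
    intro t ht
    rcases eq_or_ne t θ with rfl | hne
    · simpa using hη'
    · rw [Function.update_of_ne hne]
      exact hnear t hne ht
  have hl : θ - δ ∈ Set.Ioo (θ - ε) (θ + ε) := ⟨by linarith, by linarith⟩
  have hu : θ + δ ∈ Set.Ioo (θ - ε) (θ + ε) := ⟨by linarith, by linarith⟩
  have hpt : ∀ t, t ∈ Set.Ioo (θ - ε) (θ + ε) → |t - θ| = δ →
      ∀ᶠ n in atTop, ‖c n t - p‖ < 2 * η' := by
    intro t ht htδ
    have hne : t ≠ θ := by
      rintro rfl
      simp only [sub_self, abs_zero] at htδ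
      exact hδ.ne htδ
    have hsub : {t} ⊆ Set.Ioo (θ - ε) θ ∪ Set.Ioo θ (θ + ε) := by
      rw [Set.singleton_subset_iff]
      exact hne.lt_or_gt.imp (fun h => ⟨ht.1, h⟩) (fun h => ⟨h, ht.2⟩)
    filter_upwards [Metric.tendstoUniformlyOn_iff.1 (hconv {t} hsub isCompact_singleton).1 η' hη']
      with n hn
    have h := hn t rfl
    rw [dist_comm, dist_eq_norm] at h
    linarith [norm_sub_le_norm_sub_add_norm_sub (c n t) (ctilde t) p, hnear t hne htδ.le]
  have hfar : K \ Set.Ioo (θ - δ) (θ + δ) ⊆ Set.Ioo (θ - ε) θ ∪ Set.Ioo θ (θ + ε) := by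
    rintro t ⟨htK, ht⟩
    have hne : t ≠ θ := by
      rintro rfl
      exact ht ⟨by linarith, by linarith⟩
    exact hne.lt_or_gt.imp (fun h => ⟨(hK htK).1, h⟩) (fun h => ⟨h, (hK htK).2⟩)
  filter_upwards [hpt _ hl (by rw [sub_sub_cancel_left, abs_neg, abs_of_pos hδ]),
    hpt _ hu (by rw [add_sub_cancel_left, abs_of_pos hδ]),
    Metric.tendstoUniformlyOn_iff.1 (hconv _ hfar (hKc.diff isOpen_Ioo)).1 η hη]
    with n hnl hnu hnfar t htK
  by_cases ht : t ∈ Set.Ioo (θ - δ) (θ + δ)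
  · have hb := (hc n).norm_sub_le hε p hl hu ht.1.le ht.2.le
    have hq := hnear' t (abs_le.2 ⟨by linarith [ht.1], by linarith [ht.2]⟩)
    calc dist (Function.update ctilde θ p t) (c n t)
        ≤ dist (Function.update ctilde θ p t) p + dist (c n t) p := dist_triangle_right _ _ _
      _ < η := by
        rw [dist_eq_norm, dist_eq_norm]
        linarith
  · have hne : t ≠ θ := by
      rintro rfl
      exact ht ⟨by linarith, by linarith⟩
    rw [Function.update_of_ne hne]
    exact hnfar t ⟨htK, ht⟩
end
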